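/- arXiv:1710.06082 — 2 statements merged into one kernel-verified Lean document; each statement's English description precedes it below -/
import Mathlib

section
/- Let M : ℕ × ℕ → ℝ induce a bounded operator on ℓ² which is elliptic with constant C_ell > 0, fix a block structure on ℕ, and assume M is block-banded with bandwidth b₀. Then the normalized block-LU-factorization M = LU exists: there are matrices L, U with L block-lower triangular and L(i,i) = I (identity blocks) for all i, U block-upper triangular, M_{pq} = Σ_r L_{pr} U_{rq} for all p,q (the sums having only finitely many nonzero terms by triangularity), L and U block-banded with bandwidth b₀, and L and U induce bounded operators on ℓ² which are invertible with bounded inverses, i.e. ‖L‖₂ + ‖U‖₂ + ‖L⁻¹‖₂ + ‖U⁻¹‖₂ < ∞. Moreover, the block-diagonal matrix D defined by D(i,i) := U(i,i) induces a bounded elliptic operator on ℓ², and D⁻¹ is also bounded and elliptic. -/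
abbrev Mat := ℕ → ℕ → ℝ

noncomputable def mulVec (M : Mat) (x : ℕ → ℝ) : ℕ → ℝ := fun i => ∑' j, M i j * x j

def Memℓ2 (x : ℕ → ℝ) : Prop := Summable fun i => x i ^ 2

noncomputable def l2norm (x : ℕ → ℝ) : ℝ := Real.sqrt (∑' i, x i ^ 2)

def BoundedWith (M : Mat) (K : ℝ) : Prop :=
  ∀ x : ℕ → ℝ, Memℓ2 x →
    (∀ i, Summable fun j => |M i j * x j|) ∧ Memℓ2 (mulVec M x) ∧
      l2norm (mulVec M x) ≤ K * l2norm x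

def IsBoundedOp (M : Mat) : Prop := ∃ K : ℝ, 0 ≤ K ∧ BoundedWith M K

def Elliptic (M : Mat) (c : ℝ) : Prop :=
  ∀ x : ℕ → ℝ, Memℓ2 x → c * (∑' i, x i ^ 2) ≤ ∑' i, mulVec M x i * x i

def IsBlockStructure (n : ℕ → ℕ) : Prop := StrictMono n ∧ n 0 = 0

def InBlock (n : ℕ → ℕ) (i p : ℕ) : Prop := n i ≤ p ∧ p < n (i + 1)

def BlockBanded (n : ℕ → ℕ) (b : ℕ) (M : Mat) : Prop :=
  ∀ i j p q, InBlock n i p → InBlock n j q → (b : ℤ) < |(i : ℤ) - (j : ℤ)| → M p q = 0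

def BlockLower (n : ℕ → ℕ) (M : Mat) : Prop :=
  ∀ i j p q, InBlock n i p → InBlock n j q → i < j → M p q = 0

def BlockUpper (n : ℕ → ℕ) (M : Mat) : Prop :=
  ∀ i j p q, InBlock n i p → InBlock n j q → j < i → M p q = 0

def idMat : Mat := fun p q => if p = q then 1 else 0

/-- The diagonal blocks are identity blocks: `M(i,i) = I`. -/
def UnitDiagBlocks (n : ℕ → ℕ) (M : Mat) : Prop :=
  ∀ i p q, InBlock n i p → InBlock n i q → M p q = idMat p q

def IsInverseOn (M N : Mat) : Prop :=
  ∀ x : ℕ → ℝ, Memℓ2 x →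
    Memℓ2 (mulVec M x) ∧ Memℓ2 (mulVec N x) ∧
      mulVec N (mulVec M x) = x ∧ mulVec M (mulVec N x) = x

open Classical in
/-- The block diagonal part of a matrix. -/
noncomputable def blockDiagOf (n : ℕ → ℕ) (M : Mat) : Mat :=
  fun p q => if ∃ i, InBlock n i p ∧ InBlock n i q then M p q else 0

abbrev HH := lp (fun _ : ℕ => ℝ) 2

abbrev OpH := HH →L[ℝ] HH

theorem memℓ2_iff (x : ℕ → ℝ) : Memℓ2 x ↔ Memℓp x 2 := by
  rw [memℓp_gen_iff (by norm_num)]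
  simp [Memℓ2]

theorem mem_coe (x : HH) : Memℓ2 (x : ℕ → ℝ) := (memℓ2_iff _).2 x.2

theorem normsq (x : HH) : ‖x‖ ^ 2 = ∑' i, x i ^ 2 := by
  have := lp.norm_rpow_eq_tsum (p := 2) (by norm_num) x
  simpa using this

theorem l2norm_coe (x : HH) : l2norm (x : ℕ → ℝ) = ‖x‖ := by
  rw [l2norm, ← normsq, Real.sqrt_sq (norm_nonneg _)]

theorem inner_coe (x y : HH) : inner ℝ x y = ∑' i, x i * y i := by
  rw [lp.inner_eq_tsum]
  simp [mul_comm]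

/-- Turn a square-summable sequence into an element of `HH`. -/
def toH (x : ℕ → ℝ) (hx : Memℓ2 x) : HH := ⟨x, (memℓ2_iff x).1 hx⟩

@[simp] theorem toH_coe (x : ℕ → ℝ) (hx : Memℓ2 x) : (toH x hx : ℕ → ℝ) = x := rfl

noncomputable def ee (q : ℕ) : HH := lp.single 2 q (1 : ℝ)

theorem ee_apply (q p : ℕ) : (ee q : ℕ → ℝ) p = if p = q then 1 else 0 := by
  simp [ee, Pi.single_apply]

theorem inner_ee (q : ℕ) (x : HH) : inner ℝ (ee q) x = x q := by
  rw [ee, lp.inner_single_left]; simp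

theorem inner_ee' (q : ℕ) (x : HH) : inner ℝ x (ee q) = x q := by
  rw [ee, lp.inner_single_right]; simp

theorem op_ext {A B : OpH} (h : ∀ q, A (ee q) = B (ee q)) : A = B := by
  apply lp.ext_continuousLinearMap (by norm_num)
  intro i
  ext1
  simpa [ee] using h i

noncomputable def mat (T : OpH) : Mat := fun p q => (T (ee q) : ℕ → ℝ) p

theorem mat_eq_adj (T : OpH) (p q : ℕ) :
    mat T p q = (ContinuousLinearMap.adjoint T (ee p) : ℕ → ℝ) q := by
  rw [mat, ← inner_ee, ← inner_ee', ContinuousLinearMap.adjoint_inner_left]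

theorem mat_hasSum (T : OpH) (x : HH) (p : ℕ) :
    HasSum (fun q => mat T p q * x q) ((T x : ℕ → ℝ) p) := by
  have h := lp.hasSum_inner (𝕜 := ℝ) (ContinuousLinearMap.adjoint T (ee p)) x
  rw [ContinuousLinearMap.adjoint_inner_left, inner_ee] at h
  refine h.congr_fun ?_
  intro q
  simp [mat_eq_adj, mul_comm]

theorem mulVec_mat (T : OpH) (x : HH) : mulVec (mat T) (x : ℕ → ℝ) = (T x : ℕ → ℝ) := by
  funext p
  exact (mat_hasSum T x p).tsum_eq

theorem mat_bounded (T : OpH) : IsBoundedOp (mat T) := by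
  refine ⟨‖T‖, norm_nonneg _, ?_⟩
  intro x hx
  have e : x = (toH x hx : ℕ → ℝ) := rfl
  rw [e, mulVec_mat, l2norm_coe, l2norm_coe]
  exact ⟨fun i => (mat_hasSum T (toH x hx) i).summable.abs, mem_coe _, T.le_opNorm _⟩

theorem mat_inverse (T S : OpH) (h1 : T * S = 1) (h2 : S * T = 1) :
    IsInverseOn (mat T) (mat S) := by
  intro x hx
  have e : x = (toH x hx : ℕ → ℝ) := rfl
  rw [e]
  simp only [mulVec_mat]
  refine ⟨mem_coe _, mem_coe _, ?_, ?_⟩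
  · exact congrArg (fun A : OpH => ((A (toH x hx) : HH) : ℕ → ℝ)) h2
  · exact congrArg (fun A : OpH => ((A (toH x hx) : HH) : ℕ → ℝ)) h1

theorem elliptic_mat (T : OpH) (c : ℝ) :
    Elliptic (mat T) c ↔ ∀ x : HH, c * ‖x‖ ^ 2 ≤ inner ℝ (T x) x := by
  constructor
  · intro h x
    have := h x (mem_coe x)
    rwa [mulVec_mat, ← normsq, ← inner_coe] at this
  · intro h x hx
    have e : x = (toH x hx : ℕ → ℝ) := rfl
    rw [e, mulVec_mat, ← normsq, ← inner_coe]
    exact h _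

theorem exists_op (M : Mat) (h : IsBoundedOp M) : ∃ T : OpH, mat T = M := by
  obtain ⟨K, hK, hM⟩ := h
  let F : HH →ₗ[ℝ] HH :=
    { toFun := fun x => toH (mulVec M x) (hM x (mem_coe x)).2.1
      map_add' := by
        intro x y
        apply lp.ext
        funext i
        have hx := ((hM x (mem_coe x)).1 i).of_abs
        have hy := ((hM y (mem_coe y)).1 i).of_abs
        simp only [toH_coe, mulVec, lp.coeFn_add, Pi.add_apply]
        rw [← hx.tsum_add hy]
        simp only [mul_add]
      map_smul' := by
        intro a x
        apply lp.ext
        funext i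
        simp only [toH_coe, mulVec, lp.coeFn_smul, Pi.smul_apply, smul_eq_mul, RingHom.id_apply]
        rw [← tsum_mul_left]
        congr 1; funext j; ring }
  refine ⟨F.mkContinuous K ?_, ?_⟩
  · intro x
    have := (hM x (mem_coe x)).2.2
    rw [l2norm_coe] at this
    rwa [← l2norm_coe (F x)]
  · funext p q
    change mulVec M (ee q) p = _
    simp only [mulVec, ee_apply]
    simp

theorem lax_milgram (A : OpH) (c : ℝ) (hc : 0 < c)
    (h : ∀ x : HH, c * ‖x‖ ^ 2 ≤ inner ℝ (A x) x) :
    ∃ B : OpH, A * B = 1 ∧ B * A = 1 ∧ ‖B‖ ≤ c⁻¹ := by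
  let F : HH →L[ℝ] HH →L[ℝ] ℝ := (innerSL ℝ).comp A
  have hF : IsCoercive F := ⟨c, hc, fun u => by
    have := h u
    simp only [F, ContinuousLinearMap.comp_apply, innerSL_apply_apply]
    linarith [this, sq ‖u‖]⟩
  let e := hF.continuousLinearEquivOfBilin
  have he : ∀ x, e x = A x := by
    intro x
    refine ext_inner_right ℝ fun w => ?_
    rw [hF.continuousLinearEquivOfBilin_apply]
    simp [F]
  refine ⟨e.symm, ?_, ?_, ?_⟩
  · ext1 x
    simp [← he]
  · ext1 x
    simp [← he]
  · refine ContinuousLinearMap.opNorm_le_bound _ (by positivity) fun x => ?_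
    have h1 := h (e.symm x)
    rw [← he] at h1
    simp only [ContinuousLinearEquiv.apply_symm_apply] at h1
    have h2 := real_inner_le_norm x (e.symm x)
    simp only [ContinuousLinearEquiv.coe_coe]
    rw [inv_mul_eq_div, le_div_iff₀ hc]
    rcases (norm_nonneg (e.symm x)).eq_or_lt with h0 | h0
    · rw [← h0]; simp
    · nlinarith

theorem ind_mem (s : Set ℕ) (x : HH) : Memℓ2 (s.indicator (x : ℕ → ℝ)) := by
  refine Summable.of_nonneg_of_le (fun i => sq_nonneg _) (fun i => ?_) (mem_coe x)
  by_cases h : i ∈ s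
  · simp [h]
  · simp [h, sq_nonneg]

/-- Coordinate projection onto the index set `s`. -/
noncomputable def proj (s : Set ℕ) : OpH :=
  LinearMap.mkContinuous
    { toFun := fun x => toH (s.indicator (x : ℕ → ℝ)) (ind_mem s x)
      map_add' := by
        intro x y
        apply lp.ext
        funext i
        simp only [toH_coe, lp.coeFn_add, Pi.add_apply]
        by_cases h : i ∈ s <;> simp [h]
      map_smul' := by
        intro a x
        apply lp.ext
        funext i
        simp only [toH_coe, lp.coeFn_smul, Pi.smul_apply, smul_eq_mul, RingHom.id_apply]
        by_cases h : i ∈ s <;> simp [h] } 1 (by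
    intro x
    refine abs_le_of_sq_le_sq' ?_ (by positivity) |>.2
    rw [one_mul, normsq, normsq]
    refine Summable.tsum_le_tsum (fun i => ?_) (ind_mem s x) (mem_coe x)
    by_cases h : i ∈ s
    · simp [h]
    · simp [h, sq_nonneg])

theorem proj_coe (s : Set ℕ) (x : HH) : (proj s x : ℕ → ℝ) = s.indicator (x : ℕ → ℝ) := rfl

theorem proj_apply_mem {s : Set ℕ} {p : ℕ} (h : p ∈ s) (x : HH) :
    (proj s x : ℕ → ℝ) p = (x : ℕ → ℝ) p := by
  rw [proj_coe]; simp [h]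

theorem proj_apply_notMem {s : Set ℕ} {p : ℕ} (h : p ∉ s) (x : HH) :
    (proj s x : ℕ → ℝ) p = 0 := by
  rw [proj_coe]; simp [h]

theorem proj_norm_le (s : Set ℕ) (x : HH) : ‖proj s x‖ ≤ ‖x‖ := by
  have h : ‖proj s‖ ≤ 1 := LinearMap.mkContinuous_norm_le _ zero_le_one _
  simpa using (proj s).le_of_opNorm_le h x

theorem proj_opnorm_le (s : Set ℕ) : ‖proj s‖ ≤ 1 :=
  LinearMap.mkContinuous_norm_le _ zero_le_one _

theorem proj_mul (s t : Set ℕ) : proj s * proj t = proj (s ∩ t) := by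
  ext x p
  change (proj s (proj t x) : ℕ → ℝ) p = _
  simp only [proj_coe, Set.indicator_indicator]

theorem proj_idem (s : Set ℕ) : proj s * proj s = proj s := by
  rw [proj_mul, Set.inter_self]

theorem proj_empty : proj ∅ = 0 := by
  ext x p
  simp [proj_coe]

theorem proj_inner (s : Set ℕ) (x y : HH) : inner ℝ (proj s x) y = inner ℝ x (proj s y) := by
  rw [inner_coe, inner_coe]
  congr 1; funext i
  by_cases h : i ∈ s
  · simp [proj_apply_mem h]
  · simp [proj_apply_notMem h]

theorem proj_ee_mem {s : Set ℕ} {q : ℕ} (h : q ∈ s) : proj s (ee q) = ee q := by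
  apply lp.ext
  funext p
  by_cases hp : p ∈ s
  · rw [proj_apply_mem hp]
  · rw [proj_apply_notMem hp, ee_apply, if_neg]
    rintro rfl; exact hp h

theorem proj_ee_notMem {s : Set ℕ} {q : ℕ} (h : q ∉ s) : proj s (ee q) = 0 := by
  apply lp.ext
  funext p
  by_cases hp : p ∈ s
  · rw [proj_apply_mem hp, ee_apply, if_neg]
    · rfl
    · rintro rfl; exact h hp
  · rw [proj_apply_notMem hp]; rfl

theorem proj_adj (s : Set ℕ) : ContinuousLinearMap.adjoint (proj s) = proj s := by
  symm
  rw [ContinuousLinearMap.eq_adjoint_iff]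
  exact proj_inner s

/-- Projection on block `k`. -/
noncomputable def Qb (n : ℕ → ℕ) (k : ℕ) : OpH := proj {p | InBlock n k p}

/-- Projection on the blocks before `k`. -/
noncomputable def Pb (n : ℕ → ℕ) (k : ℕ) : OpH := proj {p | p < n k}


theorem exists_block {n : ℕ → ℕ} (hn : IsBlockStructure n) (p : ℕ) : ∃ k, InBlock n k p := by
  classical
  have h : ∃ k, p < n (k + 1) := ⟨p, lt_of_lt_of_le (Nat.lt_succ_self p) (hn.1.id_le _)⟩
  refine ⟨Nat.find h, ?_, Nat.find_spec h⟩
  rcases hk : Nat.find h with _ | k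
  · rw [hn.2]; omega
  · have := Nat.find_min h (m := k) (by omega)
    omega

theorem block_lt {n : ℕ → ℕ} (hn : IsBlockStructure n) {i j p q : ℕ} (hp : InBlock n i p) (hq : InBlock n j q) (h : i < j) : p < q := by
  have : n (i + 1) ≤ n j := hn.1.monotone h
  have := hp.2
  have := hq.1
  omega

theorem block_unique {n : ℕ → ℕ} (hn : IsBlockStructure n) {i j p : ℕ} (hp : InBlock n i p) (hq : InBlock n j p) : i = j := by
  rcases lt_trichotomy i j with h | h | h
  · exact absurd (block_lt hn hp hq h) (lt_irrefl _)
  · exact h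
  · exact absurd (block_lt hn hq hp h) (lt_irrefl _)

theorem lt_iff_block {n : ℕ → ℕ} (hn : IsBlockStructure n) {j k p : ℕ} (hp : InBlock n j p) : p < n k ↔ j < k := by
  constructor
  · intro h
    by_contra h'
    have : n k ≤ n j := hn.1.monotone (by omega)
    have := hp.1
    omega
  · intro h
    have : n (j + 1) ≤ n k := hn.1.monotone h
    have := hp.2
    omega

theorem Qb_mul_ne {n : ℕ → ℕ} (hn : IsBlockStructure n) {i j : ℕ} (h : i ≠ j) : Qb n i * Qb n j = 0 := by
  rw [Qb, Qb, proj_mul, ← proj_empty]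
  congr 1
  ext p
  simp only [Set.mem_inter_iff, Set.mem_ofPred_eq, Set.mem_empty_iff_false, iff_false]
  rintro ⟨h1, h2⟩
  exact h (block_unique hn h1 h2)

theorem Qb_Pb {n : ℕ → ℕ} (hn : IsBlockStructure n) {j k : ℕ} (h : j < k) : Qb n j * Pb n k = Qb n j := by
  rw [Qb, Pb, proj_mul]
  congr 1
  ext p
  simp only [Set.mem_inter_iff, Set.mem_ofPred_eq, and_iff_left_iff_imp]
  intro h1
  exact (lt_iff_block hn h1).2 h

theorem Pb_Qb {n : ℕ → ℕ} (hn : IsBlockStructure n) {j k : ℕ} (h : j < k) : Pb n k * Qb n j = Qb n j := by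
  rw [← Qb_Pb hn h, Qb, Pb, proj_mul, proj_mul]
  congr 1
  ext p
  simp

theorem Qb_Pb' {n : ℕ → ℕ} (hn : IsBlockStructure n) {j k : ℕ} (h : k ≤ j) : Qb n j * Pb n k = 0 := by
  rw [Qb, Pb, proj_mul, ← proj_empty]
  congr 1
  ext p
  simp only [Set.mem_inter_iff, Set.mem_ofPred_eq, Set.mem_empty_iff_false, iff_false]
  rintro ⟨h1, h2⟩
  have := (lt_iff_block hn h1).1 h2
  omega

theorem Pb_Qb' {n : ℕ → ℕ} (hn : IsBlockStructure n) {j k : ℕ} (h : k ≤ j) : Pb n k * Qb n j = 0 := by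
  rw [← Qb_Pb' hn h, Qb, Pb, proj_mul, proj_mul, Set.inter_comm]

theorem Pb_zero {n : ℕ → ℕ} (hn : IsBlockStructure n) : Pb n 0 = 0 := by
  rw [Pb, hn.2, ← proj_empty]
  congr 1
  ext p
  simp

theorem Pb_succ {n : ℕ → ℕ} (hn : IsBlockStructure n) (k : ℕ) : Pb n (k + 1) = Pb n k + Qb n k := by
  apply op_ext
  intro q
  obtain ⟨j, hj⟩ := exists_block hn q
  simp only [add_apply, Pb, Qb]
  rcases lt_trichotomy j k with h | h | h
  · rw [proj_ee_mem (s := {p | p < n (k+1)}), proj_ee_mem (s := {p | p < n k}), proj_ee_notMem]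
    · simp
    · intro h'; have := block_unique hn hj h'; omega
    · exact (lt_iff_block hn hj).2 h
    · exact (lt_iff_block hn hj).2 (by omega)
  · subst h
    rw [proj_ee_mem (s := {p | p < n (j+1)}), proj_ee_notMem (s := {p | p < n j}), proj_ee_mem]
    · simp
    · exact hj
    · intro h'; have := (lt_iff_block hn hj).1 h'; omega
    · exact (lt_iff_block hn hj).2 (by omega)
  · rw [proj_ee_notMem (s := {p | p < n (k+1)}), proj_ee_notMem (s := {p | p < n k}),
      proj_ee_notMem]
    · simp
    · intro h'; have := block_unique hn hj h'; omega
    · intro h'; have := (lt_iff_block hn hj).1 h'; omega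
    · intro h'; have := (lt_iff_block hn hj).1 h'; omega

theorem ext_left {n : ℕ → ℕ} (hn : IsBlockStructure n) {A B : OpH} (h : ∀ k, Qb n k * A = Qb n k * B) : A = B := by
  ext x p
  obtain ⟨k, hk⟩ := exists_block hn p
  have := congrArg (fun C : OpH => ((C x : HH) : ℕ → ℝ) p) (h k)
  change (proj {p | InBlock n k p} (A x) : ℕ → ℝ) p = (proj {p | InBlock n k p} (B x) : ℕ → ℝ) p
    at this
  rwa [proj_apply_mem (by exact hk), proj_apply_mem (by exact hk)] at this

theorem ext_right {n : ℕ → ℕ} (hn : IsBlockStructure n) {A B : OpH} (h : ∀ k, A * Qb n k = B * Qb n k) : A = B := by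
  apply op_ext
  intro q
  obtain ⟨k, hk⟩ := exists_block hn q
  have := congrArg (fun C : OpH => C (ee q)) (h k)
  change A (proj {p | InBlock n k p} (ee q)) = B (proj {p | InBlock n k p} (ee q)) at this
  rwa [proj_ee_mem (by exact hk)] at this

theorem entry_block {n : ℕ → ℕ} (A : OpH) {i j p q : ℕ} (hp : InBlock n i p) (hq : InBlock n j q) :
    mat A p q = mat (Qb n i * A * Qb n j) p q := by
  change _ = (proj {p | InBlock n i p} (A (proj {p | InBlock n j p} (ee q))) : ℕ → ℝ) p
  rw [proj_ee_mem (by exact hq), proj_apply_mem (by exact hp)]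
  rfl

theorem block_zero {n : ℕ → ℕ} (A : OpH) {i j : ℕ}
    (h : ∀ p q, InBlock n i p → InBlock n j q → mat A p q = 0) : Qb n i * A * Qb n j = 0 := by
  apply op_ext
  intro q
  apply lp.ext
  funext p
  change (proj {p | InBlock n i p} (A (proj {p | InBlock n j p} (ee q))) : ℕ → ℝ) p = 0
  by_cases hq : InBlock n j q
  · rw [proj_ee_mem (by exact hq)]
    by_cases hp : InBlock n i p
    · rw [proj_apply_mem (by exact hp)]
      exact h p q hp hq
    · rw [proj_apply_notMem (by exact hp)]
  · rw [proj_ee_notMem (by exact hq)]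
    simp

theorem exists_rows {n : ℕ → ℕ} (hn : IsBlockStructure n) (b : ℕ) (K : ℝ) (T : ℕ → OpH) (hK : ∀ k, ‖T k‖ ≤ K)
    (hb : ∀ k j : ℕ, (b : ℤ) < |(k : ℤ) - (j : ℤ)| → Qb n k * T k * Qb n j = 0) :
    ∃ U : OpH, ∀ k, Qb n k * U = Qb n k * T k := by
  classical
  have hK0 : 0 ≤ K := (norm_nonneg _).trans (hK 0)
  choose blk hblk using exists_block hn
  let E : ℕ → OpH := fun k => proj {p | |(k : ℤ) - (blk p : ℤ)| ≤ b}
  have hE : ∀ k, Qb n k * T k = Qb n k * T k * E k := by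
    intro k
    apply op_ext
    intro q
    change (Qb n k * T k) (ee q) = (Qb n k * T k) (E k (ee q))
    by_cases hq : |(k : ℤ) - (blk q : ℤ)| ≤ b
    · rw [proj_ee_mem (by exact hq)]
    · rw [proj_ee_notMem (by exact hq), map_zero]
      have := congrArg (fun C : OpH => C (ee q)) (hb k (blk q) (by omega))
      change (Qb n k * T k) (proj {p | InBlock n (blk q) p} (ee q)) = 0 at this
      rwa [proj_ee_mem (by exact hblk q)] at this
  have hQT : ∀ k x, ‖Qb n k (T k x)‖ ^ 2 ≤ K ^ 2 * ‖E k x‖ ^ 2 := by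
    intro k x
    rw [← mul_pow]
    refine pow_le_pow_left₀ (norm_nonneg _) ?_ 2
    have h1 : Qb n k (T k x) = Qb n k (T k (E k x)) :=
      congrArg (fun C : OpH => C x) (hE k)
    rw [h1]
    exact (proj_norm_le _ _).trans ((T k).le_of_opNorm_le (hK k) _)
  have hEs : ∀ (t : Finset ℕ) (x : HH), ∑ k ∈ t, ‖E k x‖ ^ 2 ≤ (2 * b + 1) * ‖x‖ ^ 2 := by
    intro t x
    simp only [normsq]
    rw [← Summable.tsum_finsetSum (fun k _ => mem_coe (E k x)), ← tsum_mul_left]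
    refine Summable.tsum_le_tsum (fun p => ?_) (summable_sum (fun k _ => mem_coe (E k x)))
      ((mem_coe x).mul_left _)
    have h1 : ∀ k ∈ t, (E k x : ℕ → ℝ) p ^ 2
        = if |(k : ℤ) - (blk p : ℤ)| ≤ b then (x : ℕ → ℝ) p ^ 2 else 0 := by
      intro k _
      by_cases hq : |(k : ℤ) - (blk p : ℤ)| ≤ b
      · rw [if_pos hq, proj_apply_mem (by exact hq)]
      · rw [if_neg hq, proj_apply_notMem (by exact hq)]; simp
    rw [Finset.sum_congr rfl h1, ← Finset.sum_filter, Finset.sum_const, nsmul_eq_mul]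
    refine mul_le_mul_of_nonneg_right ?_ (sq_nonneg _)
    have h2 : (t.filter fun k : ℕ => |(k : ℤ) - (blk p : ℤ)| ≤ b) ⊆
        Finset.Icc (blk p - b) (blk p + b) := by
      intro k hk
      have := (Finset.mem_filter.1 hk).2
      rw [abs_le] at this
      rw [Finset.mem_Icc]
      omega
    have h3 := Finset.card_le_card h2
    rw [Nat.card_Icc] at h3
    have h4 : (t.filter fun k : ℕ => |(k : ℤ) - (blk p : ℤ)| ≤ b).card ≤ 2 * b + 1 := by omega
    exact_mod_cast h4
  have key : ∀ (x : HH) (s : Finset ℕ),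
      ∑ p ∈ s, ((T (blk p) x : HH) : ℕ → ℝ) p ^ 2 ≤ K ^ 2 * ((2 * b + 1) * ‖x‖ ^ 2) := by
    intro x s
    rw [← Finset.sum_fiberwise_of_maps_to (t := s.image blk) (g := blk)
      (fun p hp => Finset.mem_image_of_mem _ hp)]
    refine le_trans ?_ (mul_le_mul_of_nonneg_left (hEs (s.image blk) x) (sq_nonneg K))
    rw [Finset.mul_sum]
    refine Finset.sum_le_sum fun k _ => ?_
    refine le_trans ?_ (hQT k x)
    rw [normsq]
    refine le_trans (le_of_eq ?_) ((mem_coe (Qb n k (T k x))).sum_le_tsum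
      (s.filter fun p => blk p = k) (fun i _ => sq_nonneg _))
    refine Finset.sum_congr rfl fun p hp => ?_
    have hp' := (Finset.mem_filter.1 hp).2
    subst hp'
    rw [Qb, proj_apply_mem (by exact hblk p)]
  have hmem : ∀ x : HH, Memℓ2 (fun p => ((T (blk p) x : HH) : ℕ → ℝ) p) := fun x =>
    summable_of_sum_le (fun i => sq_nonneg _) (key x)
  let F : HH →ₗ[ℝ] HH :=
    { toFun := fun x => toH _ (hmem x)
      map_add' := by
        intro x y
        apply lp.ext
        funext i
        simp
        rfl
      map_smul' := by
        intro a x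
        apply lp.ext
        funext i
        simp }
  refine ⟨F.mkContinuous (Real.sqrt (K ^ 2 * (2 * b + 1))) ?_, ?_⟩
  · intro x
    refine abs_le_of_sq_le_sq' ?_ (by positivity) |>.2
    rw [mul_pow, Real.sq_sqrt (by positivity), normsq (F x), mul_assoc]
    exact (hmem x).tsum_le_of_sum_le (key x)
  · intro k
    ext x p
    change (proj {p | InBlock n k p} (F x) : ℕ → ℝ) p
      = (proj {p | InBlock n k p} (T k x) : ℕ → ℝ) p
    by_cases hp : InBlock n k p
    · rw [proj_apply_mem (by exact hp), proj_apply_mem (by exact hp)]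
      have := block_unique hn hp (hblk p)
      subst this
      rfl
    · rw [proj_apply_notMem (by exact hp), proj_apply_notMem (by exact hp)]

theorem schur_facts {A : Type*} [Ring A] (P M B : A) (hP : P * P = P)
    (h1 : (P * M * P + (1 - P)) * B = 1) (h2 : B * (P * M * P + (1 - P)) = 1) :
    (B * P) * P = B * P ∧ P * (B * P) = B * P ∧ (B * P) * M * P = P ∧ P * M * (B * P) = P := by
  have hAP : (P * M * P + (1 - P)) * P = P * M * P := by
    calc _ = P * M * (P * P) + (P - P * P) := by noncomm_ring
      _ = _ := by rw [hP]; simp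
  have hPA : P * (P * M * P + (1 - P)) = P * M * P := by
    calc _ = (P * P) * M * P + (P - P * P) := by noncomm_ring
      _ = _ := by rw [hP]; simp
  have hPB : P * B = B * P := by
    calc P * B = (B * (P * M * P + (1 - P))) * P * B := by rw [h2, one_mul]
      _ = B * ((P * M * P + (1 - P)) * P) * B := by simp only [mul_assoc]
      _ = B * (P * (P * M * P + (1 - P))) * B := by rw [hAP, hPA]
      _ = B * P * ((P * M * P + (1 - P)) * B) := by simp only [mul_assoc]
      _ = _ := by rw [h1, mul_one]
  refine ⟨?_, ?_, ?_, ?_⟩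
  · rw [mul_assoc, hP]
  · rw [← mul_assoc, hPB, mul_assoc, hP]
  · calc _ = B * (P * M * P) := by simp only [mul_assoc]
      _ = B * ((P * M * P + (1 - P)) * P) := by rw [hAP]
      _ = (B * (P * M * P + (1 - P))) * P := by simp only [mul_assoc]
      _ = _ := by rw [h2, one_mul]
  · rw [← hPB]
    calc _ = (P * M * P) * B := by simp only [mul_assoc]
      _ = (P * (P * M * P + (1 - P))) * B := by rw [hPA]
      _ = P * ((P * M * P + (1 - P)) * B) := by simp only [mul_assoc]
      _ = _ := by rw [h1, mul_one]

theorem exists_R (M : OpH) (c : ℝ) (hc : 0 < c)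
    (h : ∀ x : HH, c * ‖x‖ ^ 2 ≤ inner ℝ (M x) x) (s : Set ℕ) :
    ∃ R : OpH, R * proj s = R ∧ proj s * R = R ∧ R * M * proj s = proj s ∧
      proj s * M * R = proj s ∧ ‖R‖ ≤ (min c 1)⁻¹ := by
  have hm : 0 < min c 1 := lt_min hc one_pos
  obtain ⟨B, h1, h2, h3⟩ := lax_milgram (proj s * M * proj s + (1 - proj s)) (min c 1) hm (by
    intro x
    have e1 : inner ℝ ((proj s * M * proj s + (1 - proj s)) x) x
        = inner ℝ (M (proj s x)) (proj s x) + inner ℝ (x - proj s x) x := by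
      rw [← proj_inner, ← inner_add_left]
      rfl
    have e2 : inner ℝ (x - proj s x) x = ‖x‖ ^ 2 - ‖proj s x‖ ^ 2 := by
      rw [inner_sub_left, real_inner_self_eq_norm_sq, ← real_inner_self_eq_norm_sq (proj s x),
        proj_inner s x (proj s x)]
      have : proj s (proj s x) = proj s x := congrArg (fun C : OpH => C x) (proj_idem s)
      rw [this, real_inner_comm]
    rw [e1, e2]
    have e3 := h (proj s x)
    have e4 : ‖proj s x‖ ^ 2 ≤ ‖x‖ ^ 2 := pow_le_pow_left₀ (norm_nonneg _) (proj_norm_le s x) 2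
    have e5 : min c 1 * ‖proj s x‖ ^ 2 ≤ c * ‖proj s x‖ ^ 2 :=
      mul_le_mul_of_nonneg_right (min_le_left _ _) (sq_nonneg _)
    have e6 : min c 1 * (‖x‖ ^ 2 - ‖proj s x‖ ^ 2) ≤ 1 * (‖x‖ ^ 2 - ‖proj s x‖ ^ 2) :=
      mul_le_mul_of_nonneg_right (min_le_right _ _) (by linarith)
    linarith)
  obtain ⟨a1, a2, a3, a4⟩ := schur_facts (proj s) M B (proj_idem s) h1 h2
  refine ⟨B * proj s, a1, a2, a3, a4, ?_⟩
  calc ‖B * proj s‖ ≤ ‖B‖ * ‖proj s‖ := norm_mul_le _ _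
    _ ≤ (min c 1)⁻¹ * 1 := mul_le_mul h3 (proj_opnorm_le s) (norm_nonneg _) (by positivity)
    _ = _ := mul_one _

/-- Ring-level Schur complement recursion. -/
theorem schur_step {A : Type*} [Ring A] (M P Q P' R R' S D : A)
    (hP' : P' = P + Q)
    (hQQ : Q * Q = Q) (hPR : P * R = R) (hQP : Q * P = 0)
    (hPQ : P * Q = 0)
    (hR'P : R' * P' = R') (hR'M : R' * M * P' = P')
    (hS : S = M - M * R * M) (hPS : P * S = 0)
    (hD : Q * S * Q * D = Q) :
    S - S * Q * D * Q * S = M - M * R' * M := by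
  set T := S - S * Q * D * Q * S with hT
  have hPT : P' * T = 0 := by
    have e1 : P * T = 0 := by
      calc P * T = P * S - (P * S) * Q * D * Q * S := by rw [hT]; noncomm_ring
        _ = 0 := by rw [hPS]; simp
    have e2 : Q * T = 0 := by
      calc Q * T = Q * S - (Q * S * Q * D) * Q * S := by rw [hT]; noncomm_ring
        _ = 0 := by rw [hD, hQQ, sub_self]
    rw [hP', add_mul, e1, e2, add_zero]
  set Y := R * M + Q * D * Q * S - R * M * Q * D * Q * S with hY
  have hTY : T = M - M * Y := by rw [hT, hY, hS]; noncomm_ring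
  have hPY : P' * Y = Y := by
    have f1 : P' * R = R := by
      calc P' * R = P * R + Q * R := by rw [hP', add_mul]
        _ = R + Q * (P * R) := by rw [hPR]
        _ = R + (Q * P) * R := by rw [mul_assoc]
        _ = R := by rw [hQP]; simp
    have f2 : P' * Q = Q := by rw [hP', add_mul, hPQ, hQQ, zero_add]
    calc P' * Y = (P' * R) * M + (P' * Q) * D * Q * S - (P' * R) * M * Q * D * Q * S := by
          rw [hY]; noncomm_ring
      _ = Y := by rw [f1, f2]
  have h0 : R' * T = 0 := by
    rw [← hR'P, mul_assoc, hPT, mul_zero]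
  have h3 : R' * M = Y := by
    have : R' * M - R' * M * Y = 0 := by
      rw [← h0, hTY]; noncomm_ring
    have h4 : R' * M * Y = Y := by
      rw [← hPY, ← mul_assoc, hR'M]
    rw [h4] at this
    exact sub_eq_zero.1 this
  rw [hTY, mul_assoc, h3]

theorem tendsto_Pb {n : ℕ → ℕ} (hn : IsBlockStructure n) (x y : HH) :
    Filter.Tendsto (fun k => inner ℝ (Pb n k x) y) Filter.atTop (nhds (inner ℝ x y)) := by
  have h := (lp.hasSum_inner (𝕜 := ℝ) x y).tendsto_sum_nat.comp hn.1.tendsto_atTop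
  refine h.congr fun k => ?_
  rw [lp.inner_eq_tsum, tsum_eq_sum (s := Finset.range (n k))]
  · refine Finset.sum_congr rfl fun p hp => ?_
    rw [Pb, proj_apply_mem]
    exact Finset.mem_range.1 hp
  · intro p hp
    rw [Pb, proj_apply_notMem]
    · simp
    · intro h; exact hp (Finset.mem_range.2 h)

/-- Ellipticity of a diagonal Schur complement block. -/
theorem schur_elliptic (M : OpH) (c : ℝ) (hc : 0 < c)
    (h : ∀ x : HH, c * ‖x‖ ^ 2 ≤ inner ℝ (M x) x) (s t : Set ℕ) (R S : OpH)
    (hR : proj s * R = R) (hS : S = M - M * R * M) (hPS : proj s * S = 0)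
    (hts : proj t * proj s = 0) (x : HH) :
    c * ‖proj t x‖ ^ 2 ≤ inner ℝ (S (proj t x)) (proj t x) := by
  set w := proj t x with hw
  set z := w - R (M w) with hz
  have hPR : ∀ v, proj s (R v) = R v := fun v => congrArg (fun C : OpH => C v) hR
  have hQR : ∀ v, proj t (R v) = 0 := by
    intro v
    rw [← hPR]
    exact congrArg (fun C : OpH => C (R v)) hts
  have hMz : S w = M z := by
    rw [hS, hz, map_sub]; rfl
  have hin : inner ℝ (S w) w = inner ℝ (M z) z := by
    rw [← hMz, hz, inner_sub_right, ← hPR, ← proj_inner s]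
    have : proj s (S w) = 0 := congrArg (fun C : OpH => C w) hPS
    rw [this]; simp
  have hzw : proj t z = w := by
    rw [hz, map_sub, hQR, sub_zero, hw]
    exact congrArg (fun C : OpH => C x) (proj_idem t)
  rw [hin]
  refine le_trans ?_ (h z)
  have : ‖w‖ ≤ ‖z‖ := by rw [← hzw]; exact proj_norm_le t z
  gcongr

theorem Qb_idem (n : ℕ → ℕ) (k : ℕ) : Qb n k * Qb n k = Qb n k := proj_idem _

theorem Qb_star (n : ℕ → ℕ) (k : ℕ) : star (Qb n k) = Qb n k := proj_adj _

theorem op_factor {n : ℕ → ℕ} (hn : IsBlockStructure n) (M : OpH) (c : ℝ) (hc : 0 < c)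
    (h : ∀ x : HH, c * ‖x‖ ^ 2 ≤ inner ℝ (M x) x) (b : ℕ)
    (hb : ∀ i j : ℕ, (b : ℤ) < |(i : ℤ) - (j : ℤ)| → Qb n i * M * Qb n j = 0) :
    ∃ L U D Li Ui Di : OpH,
      (∀ i j, i < j → Qb n i * L * Qb n j = 0) ∧
      (∀ i, Qb n i * L * Qb n i = Qb n i) ∧
      (∀ i j, j < i → Qb n i * U * Qb n j = 0) ∧
      L * U = M ∧
      (∀ i j : ℕ, (b : ℤ) < |(i : ℤ) - (j : ℤ)| → Qb n i * L * Qb n j = 0) ∧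
      (∀ i j : ℕ, (b : ℤ) < |(i : ℤ) - (j : ℤ)| → Qb n i * U * Qb n j = 0) ∧
      L * Li = 1 ∧ Li * L = 1 ∧ U * Ui = 1 ∧ Ui * U = 1 ∧ D * Di = 1 ∧ Di * D = 1 ∧
      (∀ i, Qb n i * D * Qb n i = Qb n i * U * Qb n i) ∧
      (∀ i j, i ≠ j → Qb n i * D * Qb n j = 0) ∧
      (∀ x : HH, c * ‖x‖ ^ 2 ≤ inner ℝ (D x) x) := by
  have hR := fun k => exists_R M c hc h {p | p < n k}
  choose R hRP hPR hRMP hPMR hRn using hR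
  change ∀ k, R k * Pb n k = R k at hRP
  change ∀ k, Pb n k * R k = R k at hPR
  change ∀ k, R k * M * Pb n k = Pb n k at hRMP
  change ∀ k, Pb n k * M * R k = Pb n k at hPMR
  obtain ⟨S, hS⟩ : ∃ S : ℕ → OpH, ∀ k, S k = M - M * R k * M := ⟨_, fun _ => rfl⟩
  have hSP : ∀ k, S k * Pb n k = 0 := by
    intro k
    calc S k * Pb n k = M * Pb n k - M * (R k * M * Pb n k) := by rw [hS]; noncomm_ring
      _ = 0 := by rw [hRMP, sub_self]
  have hPS : ∀ k, Pb n k * S k = 0 := by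
    intro k
    calc Pb n k * S k = Pb n k * M - (Pb n k * M * R k) * M := by rw [hS]; noncomm_ring
      _ = 0 := by rw [hPMR, sub_self]
  have hSn : ∀ k, ‖S k‖ ≤ ‖M‖ + ‖M‖ * (min c 1)⁻¹ * ‖M‖ := by
    intro k
    rw [hS]
    refine (norm_sub_le _ _).trans ?_
    gcongr
    refine (norm_mul_le _ _).trans ?_
    gcongr
    refine (norm_mul_le _ _).trans ?_
    gcongr
    exact hRn k
  -- bandedness of Schur complements
  have hPMQ : ∀ k j : ℕ, (k : ℤ) + b ≤ j → Pb n k * M * Qb n j = 0 := by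
    intro k j hkj
    apply ext_left hn
    intro i
    rw [mul_zero, ← mul_assoc, ← mul_assoc]
    rcases lt_or_ge i k with hik | hik
    · rw [Qb_Pb hn hik]
      exact hb i j (by rw [abs_of_neg] <;> omega)
    · rw [Qb_Pb' hn hik]; simp
  have hQMP : ∀ k j : ℕ, (k : ℤ) + b ≤ j → Qb n j * M * Pb n k = 0 := by
    intro k j hkj
    apply ext_right hn
    intro i
    rw [zero_mul, mul_assoc]
    rcases lt_or_ge i k with hik | hik
    · rw [Pb_Qb hn hik]
      exact hb j i (by rw [abs_of_pos] <;> omega)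
    · rw [Pb_Qb' hn hik]; simp
  have hlow : ∀ k j, j < k → S k * Qb n j = 0 := by
    intro k j hjk
    rw [← Pb_Qb hn hjk, ← mul_assoc, hSP, zero_mul]
  have hlow' : ∀ k j, j < k → Qb n j * S k = 0 := by
    intro k j hjk
    rw [← Qb_Pb hn hjk, mul_assoc, hPS, mul_zero]
  have hband : ∀ k j : ℕ, (b : ℤ) < |(k : ℤ) - (j : ℤ)| → Qb n k * S k * Qb n j = 0 := by
    intro k j hkj
    rcases lt_or_ge j k with hjk | hjk
    · rw [mul_assoc, hlow k j hjk, mul_zero]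
    · have hkj' := hkj
      rw [abs_of_nonpos (by omega)] at hkj'
      calc Qb n k * S k * Qb n j
          = Qb n k * M * Qb n j - Qb n k * M * (R k * Pb n k) * M * Qb n j := by
            rw [hRP, hS]; noncomm_ring
        _ = Qb n k * M * Qb n j - Qb n k * M * R k * (Pb n k * M * Qb n j) := by
            noncomm_ring
        _ = 0 := by rw [hb k j hkj, hPMQ k j (by omega)]; simp
  have hband' : ∀ k j : ℕ, (b : ℤ) < |(k : ℤ) - (j : ℤ)| → Qb n j * S k * Qb n k = 0 := by
    intro k j hkj
    rcases lt_or_ge j k with hjk | hjk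
    · rw [hlow' k j hjk, zero_mul]
    · have hkj' := hkj
      rw [abs_of_nonpos (by omega)] at hkj'
      calc Qb n j * S k * Qb n k
          = Qb n j * M * Qb n k - Qb n j * M * (Pb n k * R k) * M * Qb n k := by
            rw [hPR, hS]; noncomm_ring
        _ = Qb n j * M * Qb n k - (Qb n j * M * Pb n k) * R k * M * Qb n k := by
            noncomm_ring
        _ = 0 := by rw [hb j k (by rwa [abs_sub_comm]), hQMP k j (by omega)]; simp
  -- the operators
  obtain ⟨U, hU⟩ := exists_rows hn b _ S hSn hband
  obtain ⟨V, hV⟩ := exists_rows hn b (‖M‖ + ‖M‖ * (min c 1)⁻¹ * ‖M‖) (fun k => star (S k))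
    (fun k => (ContinuousLinearMap.adjoint.norm_map (S k)).le.trans (hSn k)) (by
      intro k j hkj
      have := congrArg star (hband' k j hkj)
      rwa [star_mul, star_mul, Qb_star, Qb_star, star_zero, ← mul_assoc] at this)
  obtain ⟨W, hWV⟩ : ∃ W : OpH, W = star V := ⟨_, rfl⟩
  have hW : ∀ k, W * Qb n k = S k * Qb n k := by
    intro k
    have := congrArg star (hV k)
    rwa [star_mul, star_mul, Qb_star, star_star, ← hWV] at this
  obtain ⟨D, hD⟩ := exists_rows hn 0 (‖M‖ + ‖M‖ * (min c 1)⁻¹ * ‖M‖) (fun k => S k * Qb n k)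
    (fun k => by
      refine (norm_mul_le _ _).trans ((mul_le_of_le_one_right (norm_nonneg _)
        (proj_opnorm_le _)).trans (hSn k))) (by
      intro k j hkj
      have : k ≠ j := by rintro rfl; simp at hkj
      rw [mul_assoc, mul_assoc, Qb_mul_ne hn this]; simp)
  have hD' : ∀ k, D * Qb n k = Qb n k * (S k * Qb n k) := by
    intro k
    apply ext_left hn
    intro j
    rw [← mul_assoc, hD]
    by_cases hjk : j = k
    · subst hjk
      simp only [mul_assoc, Qb_idem]
      rw [← mul_assoc (Qb n j) (Qb n j), Qb_idem]
    · rw [← mul_assoc (Qb n j) (Qb n k), Qb_mul_ne hn hjk, mul_assoc, mul_assoc,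
        Qb_mul_ne hn hjk]
      simp
  have hDell : ∀ x : HH, c * ‖x‖ ^ 2 ≤ inner ℝ (D x) x := by
    intro x
    have hk : ∀ k, c * inner ℝ (Pb n k x) x ≤ inner ℝ (Pb n k (D x)) x := by
      intro k
      induction k with
      | zero => simp [Pb_zero hn]
      | succ k ih =>
        rw [Pb_succ hn]
        simp only [add_apply, inner_add_left]
        have e1 : Qb n k (D x) = Qb n k (S k (Qb n k x)) := congrArg (fun C : OpH => C x) (hD k)
        have e2 := schur_elliptic M c hc h {p | p < n k} {p | InBlock n k p} (R k) (S k)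
          (hPR k) (hS k) (hPS k) (Qb_Pb' hn le_rfl) x
        have e3 : inner ℝ (Qb n k (S k (Qb n k x))) x
            = inner ℝ (S k (Qb n k x)) (Qb n k x) := proj_inner _ _ _
        have e4 : inner ℝ (Qb n k x) x = ‖Qb n k x‖ ^ 2 := by
          rw [← real_inner_self_eq_norm_sq, Qb, proj_inner, proj_inner]
          congr 1
          exact (congrArg (fun C : OpH => C x) (proj_idem _)).symm
        rw [e1, e3, e4]
        change c * ‖Qb n k x‖ ^ 2 ≤ inner ℝ (S k (Qb n k x)) (Qb n k x) at e2
        linarith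
    have t1 := (tendsto_Pb hn x x).const_mul c
    have t2 := tendsto_Pb hn (D x) x
    have := le_of_tendsto_of_tendsto' t1 t2 hk
    rwa [real_inner_self_eq_norm_sq] at this
  obtain ⟨Di, hDDi, hDiD, -⟩ := lax_milgram D c hc hDell
  have hcomm : ∀ k, D * Qb n k = Qb n k * D := fun k => by rw [hD', hD]
  have hcomm' : ∀ k, Di * Qb n k = Qb n k * Di := by
    intro k
    calc Di * Qb n k = Di * (Qb n k * (D * Di)) := by rw [hDDi, mul_one]
      _ = Di * (Qb n k * D) * Di := by simp only [mul_assoc]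
      _ = (Di * D) * Qb n k * Di := by rw [← hcomm]; simp only [mul_assoc]
      _ = _ := by rw [hDiD, one_mul]
  have hQD : ∀ k, Qb n k * S k * Qb n k * Di = Qb n k := by
    intro k
    rw [mul_assoc (Qb n k) (S k), ← hD', mul_assoc, ← hcomm', ← mul_assoc, hDDi, one_mul]
  have hstep : ∀ k, S (k + 1) = S k - S k * Qb n k * Di * Qb n k * S k := by
    intro k
    rw [hS (k + 1)]
    exact (schur_step M (Pb n k) (Qb n k) (Pb n (k + 1)) (R k) (R (k + 1)) (S k) Di
      (Pb_succ hn k) (Qb_idem n k) (hPR k) (Qb_Pb' hn le_rfl) (Pb_Qb' hn le_rfl)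
      (hRP (k + 1)) (hRMP (k + 1)) (hS k) (hPS k) (hQD k)).symm
  obtain ⟨L, hL⟩ : ∃ L : OpH, L = W * Di := ⟨_, rfl⟩
  have hLQ : ∀ k, L * Qb n k = S k * Qb n k * Di := by
    intro k
    rw [hL, mul_assoc, hcomm', ← mul_assoc, hW]
  have hLlow : ∀ i j, i < j → Qb n i * L * Qb n j = 0 := by
    intro i j hij
    rw [mul_assoc, hLQ, ← mul_assoc, ← mul_assoc, hlow' j i hij]; simp
  have hLdiag : ∀ i, Qb n i * L * Qb n i = Qb n i := by
    intro i
    rw [mul_assoc, hLQ, ← mul_assoc, ← mul_assoc, hQD]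
  have hPL : ∀ k, Pb n k * L = Pb n k * L * Pb n k := by
    intro k
    apply ext_right hn
    intro j
    rcases lt_or_ge j k with hjk | hjk
    · rw [mul_assoc _ (Pb n k), Pb_Qb hn hjk]
    · rw [mul_assoc _ (Pb n k), Pb_Qb' hn hjk, mul_zero]
      apply ext_left hn
      intro i
      rw [mul_zero, ← mul_assoc, ← mul_assoc]
      rcases lt_or_ge i k with hik | hik
      · rw [Qb_Pb hn hik]
        exact hLlow i j (by omega)
      · rw [Qb_Pb' hn hik]; simp
  have hLPU : ∀ k, L * Pb n k * U = M - S k := by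
    intro k
    induction k with
    | zero =>
      have : R 0 = 0 := by rw [← hRP, Pb_zero hn, mul_zero]
      rw [hS, this, Pb_zero hn]; simp
    | succ k ih =>
      have e : L * Qb n k * U = S k * Qb n k * Di * Qb n k * S k := by
        calc L * Qb n k * U = L * (Qb n k * Qb n k) * U := by rw [Qb_idem]
          _ = (L * Qb n k) * (Qb n k * U) := by simp only [mul_assoc]
          _ = _ := by rw [hLQ, hU]; simp only [mul_assoc]
      rw [Pb_succ hn, mul_add, add_mul, ih, e, hstep]
      abel
  have hLU : L * U = M := by
    apply ext_left hn
    intro k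
    have e : Pb n (k + 1) * (L * U) = Pb n (k + 1) * M := by
      calc Pb n (k + 1) * (L * U) = (Pb n (k + 1) * L) * U := by rw [mul_assoc]
        _ = Pb n (k + 1) * (L * Pb n (k + 1) * U) := by rw [hPL]; simp only [mul_assoc]
        _ = _ := by rw [hLPU, mul_sub, hPS, sub_zero]
    rw [← Qb_Pb hn (Nat.lt_succ_self k), mul_assoc, e, mul_assoc]
  -- invertibility
  obtain ⟨Mi, hMMi, hMiM, -⟩ := lax_milgram M c hc h
  have hLinj : ∀ A : OpH, L * A = 0 → A = 0 := by
    intro A hA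
    have hk : ∀ k, Pb n k * A = 0 := by
      intro k
      induction k with
      | zero => rw [Pb_zero hn, zero_mul]
      | succ k ih =>
        have e : Qb n k * L = Qb n k * L * Pb n (k + 1) := by
          calc Qb n k * L = Qb n k * (Pb n (k + 1) * L) := by
                rw [← mul_assoc, Qb_Pb hn (Nat.lt_succ_self k)]
            _ = Qb n k * Pb n (k + 1) * L * Pb n (k + 1) := by rw [hPL]; simp only [mul_assoc]
            _ = _ := by rw [Qb_Pb hn (Nat.lt_succ_self k)]
        have e2 : Qb n k * A = 0 := by
          calc Qb n k * A = Qb n k * L * (Pb n k * A) + (Qb n k * L * Qb n k) * A := by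
                rw [ih, hLdiag]; simp
            _ = (Qb n k * L * (Pb n k + Qb n k)) * A := by noncomm_ring
            _ = Qb n k * (L * A) := by rw [← Pb_succ hn, ← e, mul_assoc]
            _ = 0 := by rw [hA, mul_zero]
        rw [Pb_succ hn, add_mul, ih, e2, add_zero]
    apply ext_left hn
    intro k
    rw [mul_zero, ← Qb_Pb hn (Nat.lt_succ_self k), mul_assoc, hk, mul_zero]
  have hL1 : L * (U * Mi) = 1 := by rw [← mul_assoc, hLU, hMMi]
  have hL2 : (U * Mi) * L = 1 := by
    rw [← sub_eq_zero]
    apply hLinj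
    rw [mul_sub, ← mul_assoc, hL1, one_mul, mul_one, sub_self]
  have hU1 : U * (Mi * L) = 1 := by rw [← mul_assoc, hL2]
  have hU2 : (Mi * L) * U = 1 := by rw [mul_assoc, hLU, hMiM]
  refine ⟨L, U, D, U * Mi, Mi * L, Di, hLlow, hLdiag, ?_, hLU, ?_, ?_, hL1, hL2, hU1, hU2,
    hDDi, hDiD, ?_, ?_, hDell⟩
  · intro i j hij
    rw [hU, mul_assoc, hlow i j hij, mul_zero]
  · intro i j hij
    rw [mul_assoc, hLQ, ← mul_assoc, ← mul_assoc, hband' j i (by rwa [abs_sub_comm]), zero_mul]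
  · intro i j hij
    rw [hU]
    exact hband i j hij
  · intro i
    rw [hD, hU, mul_assoc, mul_assoc, Qb_idem, mul_assoc]
  · intro i j hij
    rw [← hcomm, mul_assoc, Qb_mul_ne hn hij, mul_zero]

/-- existence of a normalized block-LU-factorization `M = LU` of a
bounded, elliptic, block-banded matrix, with block-banded factors, bounded with
bounded inverses, and with bounded elliptic block diagonal `D` having bounded
elliptic inverse. -/
theorem block_LU_factorization
    (M : Mat) (hbdd : IsBoundedOp M)
    (Cell : ℝ) (hCell : 0 < Cell) (hell : Elliptic M Cell)
    (nseq : ℕ → ℕ) (hn : IsBlockStructure nseq)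
    (b₀ : ℕ) (hbb : BlockBanded nseq b₀ M) :
    ∃ L U : Mat,
      BlockLower nseq L ∧ UnitDiagBlocks nseq L ∧ BlockUpper nseq U ∧
      (∀ p q, M p q = ∑' r, L p r * U r q) ∧
      BlockBanded nseq b₀ L ∧ BlockBanded nseq b₀ U ∧
      IsBoundedOp L ∧ IsBoundedOp U ∧
      (∃ Linv : Mat, IsInverseOn L Linv ∧ IsBoundedOp Linv) ∧
      (∃ Uinv : Mat, IsInverseOn U Uinv ∧ IsBoundedOp Uinv) ∧
      IsBoundedOp (blockDiagOf nseq U) ∧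
      (∃ c : ℝ, 0 < c ∧ Elliptic (blockDiagOf nseq U) c) ∧
      (∃ Dinv : Mat, IsInverseOn (blockDiagOf nseq U) Dinv ∧ IsBoundedOp Dinv ∧
        ∃ c' : ℝ, 0 < c' ∧ Elliptic Dinv c') := by

  obtain ⟨T, rfl⟩ := exists_op M hbdd
  rw [elliptic_mat] at hell
  obtain ⟨L, U, D, Li, Ui, Di, h1, h2, h3, h4, h5, h6, l1, l2, u1, u2, d1, d2, h7, h8, h9⟩ :=
    op_factor hn T Cell hCell hell b₀ (fun i j hij =>
      block_zero T (fun p q hp hq => hbb i j p q hp hq hij))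
  have hDm : blockDiagOf nseq (mat U) = mat D := by
    funext p q
    obtain ⟨i, hi⟩ := exists_block hn p
    obtain ⟨j, hj⟩ := exists_block hn q
    unfold blockDiagOf
    by_cases hij : i = j
    · subst hij
      rw [if_pos ⟨i, hi, hj⟩, entry_block U hi hj, entry_block D hi hj, h7]
    · rw [if_neg, entry_block D hi hj, h8 i j hij]
      · rfl
      · rintro ⟨k, hk1, hk2⟩
        exact hij ((block_unique hn hi hk1).trans (block_unique hn hj hk2).symm)
  refine ⟨mat L, mat U, ?_, ?_, ?_, ?_, ?_, ?_, mat_bounded L, mat_bounded U,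
    ⟨mat Li, mat_inverse _ _ l1 l2, mat_bounded _⟩,
    ⟨mat Ui, mat_inverse _ _ u1 u2, mat_bounded _⟩, ?_⟩
  · intro i j p q hp hq hij
    rw [entry_block L hp hq, h1 i j hij]; rfl
  · intro i p q hp hq
    rw [entry_block L hp hq, h2 i]
    change (proj {p | InBlock nseq i p} (ee q) : ℕ → ℝ) p = _
    rw [proj_apply_mem (by exact hp), ee_apply]
    rfl
  · intro i j p q hp hq hij
    rw [entry_block U hp hq, h3 i j hij]; rfl
  · intro p q
    rw [← h4]
    exact ((mat_hasSum L (U (ee q)) p).tsum_eq).symm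
  · intro i j p q hp hq hij
    rw [entry_block L hp hq, h5 i j hij]; rfl
  · intro i j p q hp hq hij
    rw [entry_block U hp hq, h6 i j hij]; rfl
  · rw [hDm]
    refine ⟨mat_bounded D, ⟨Cell, hCell, (elliptic_mat D Cell).2 h9⟩,
      mat Di, mat_inverse _ _ d1 d2, mat_bounded _, Cell * ((‖D‖ + 1) ^ 2)⁻¹, by positivity, ?_⟩
    rw [elliptic_mat]
    intro x
    have e1 : D (Di x) = x := congrArg (fun C : OpH => C x) d1
    have e2 := h9 (Di x)
    rw [e1, real_inner_comm] at e2
    refine le_trans ?_ e2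
    have e3 : ‖x‖ ≤ (‖D‖ + 1) * ‖Di x‖ := by
      calc ‖x‖ = ‖D (Di x)‖ := by rw [e1]
        _ ≤ ‖D‖ * ‖Di x‖ := D.le_opNorm _
        _ ≤ _ := by gcongr; linarith
    have e4 : ‖x‖ ^ 2 ≤ (‖D‖ + 1) ^ 2 * ‖Di x‖ ^ 2 := by
      rw [← mul_pow]; gcongr
    rw [mul_assoc]
    refine mul_le_mul_of_nonneg_left ?_ hCell.le
    rw [inv_mul_le_iff₀ (by positivity)]
    exact e4
end

section
/- Let M : ℕ × ℕ → ℝ induce a bounded operator on ℓ² which is elliptic with constant C_ell > 0, fix a block structure on ℕ, assume M is block-banded with bandwidth b₀ and M ∈ B(d,b₀) for a metric d on ℕ, and let M = LU be its normalized block-LU factorization (L block-lower triangular with unit diagonal blocks, U block-upper triangular, both bounded with bounded inverses). Then there exist ε₀ > 0 and K > 0 such that for every 0 < ε ≤ ε₀ there exist b ∈ ℕ and a block-lower triangular matrix W ∈ B(d,b), block-banded with bandwidth b, with unit diagonal blocks W(i,i) = I, such that ‖L⁻¹ − W‖₂ ≤ ε and W is invertible on ℓ² with ‖W‖₂ + ‖W⁻¹‖₂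 ≤ K. -/
def IsMetric (d : ℕ → ℕ → ℝ) : Prop :=
  (∀ i j, 0 ≤ d i j) ∧ (∀ i j, d i j = 0 ↔ i = j) ∧ (∀ i j, d i j = d j i) ∧
    ∀ i j k, d i k ≤ d i j + d j k

def Banded (d : ℕ → ℕ → ℝ) (b : ℝ) (M : Mat) : Prop := ∀ i j, b < d i j → M i j = 0

def matSub (A B : Mat) : Mat := fun p q => A p q - B p q

open scoped ENNReal lp InnerProductSpace

namespace BA

abbrev H : Type := lp (fun _ : ℕ => ℝ) 2
abbrev Op := H →L[ℝ] H

noncomputable def e (q : ℕ) : H := lp.single 2 q (1 : ℝ)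

noncomputable def ent (T : Op) (p q : ℕ) : ℝ := (T (e q)) p

lemma e_apply (q p : ℕ) : (e q : H) p = if p = q then 1 else 0 := by
  simp [e, Pi.single_apply]

lemma norm_sq (x : H) : HasSum (fun i => (x i) ^ 2) (‖x‖ ^ 2) := by
  have := lp.hasSum_norm (p := 2) (by norm_num) x
  simpa using this

lemma mem_iff (x : ℕ → ℝ) : Memℓ2 x ↔ Memℓp x 2 := by
  rw [memℓp_gen_iff (by norm_num)]
  simp [Memℓ2]

lemma mem (x : H) : Memℓ2 x := (norm_sq x).summable

lemma l2norm_eq (x : H) : l2norm x = ‖x‖ := by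
  rw [l2norm, (norm_sq x).tsum_eq, Real.sqrt_sq (norm_nonneg _)]

noncomputable def mk (x : ℕ → ℝ) (h : Memℓ2 x) : H := ⟨x, (mem_iff x).1 h⟩

lemma mk_coe (x : ℕ → ℝ) (h : Memℓ2 x) : (mk x h : ℕ → ℝ) = x := rfl

lemma hasSum_apply (T : Op) (x : H) (p : ℕ) : HasSum (fun q => ent T p q * x q) ((T x) p) := by
  have h1 := lp.hasSum_single (p := 2) (by norm_num) x
  have h2 := h1.mapL T
  have h3 := h2.mapL (lp.evalCLM ℝ (fun _ : ℕ => ℝ) 2 p)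
  refine h3.congr_fun ?_
  intro q
  have : (lp.single 2 q (x q) : H) = (x q) • e q := by
    rw [e, ← lp.single_smul]; simp
  rw [this, map_smul, map_smul]
  simp [ent, mul_comm, lp.evalCLM]

lemma ext_ent {S T : Op} (h : ∀ p q, ent S p q = ent T p q) : S = T := by
  ext x p
  have h1 := hasSum_apply S x p
  have h2 := hasSum_apply T x p
  simp only [h] at h1
  exact h1.unique h2

lemma bounded_ent (T : Op) (C : ℝ) (hC : ‖T‖ ≤ C) : BoundedWith (ent T) C ∧
    ∀ x : H, mulVec (ent T) x = T x := by
  have key : ∀ x : H, mulVec (ent T) x = T x := fun x => by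
    ext p; exact (hasSum_apply T x p).tsum_eq
  refine ⟨fun x hx => ?_, key⟩
  have hk := key (mk x hx)
  rw [mk_coe] at hk
  refine ⟨fun i => (hasSum_apply T (mk x hx) i).summable.abs, ?_, ?_⟩
  · rw [hk]; exact mem _
  · rw [hk, l2norm_eq]
    have : l2norm x = ‖mk x hx‖ := l2norm_eq (mk x hx)
    rw [this]
    exact (T.le_opNorm _).trans (by gcongr)

/-- build operator -/
lemma mkop (f : H →ₗ[ℝ] (ℕ → ℝ)) (C : ℝ) (hC : 0 ≤ C)
    (h : ∀ (x : H) (F : Finset ℕ), ∑ p ∈ F, (f x p) ^ 2 ≤ C ^ 2 * ‖x‖ ^ 2) :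
    ∃ T : Op, ‖T‖ ≤ C ∧ ∀ x p, (T x) p = f x p := by
  have hm : ∀ x, Memℓ2 (f x) := fun x =>
    summable_of_sum_le (fun _ => sq_nonneg _) (h x)
  let g : H →ₗ[ℝ] H :=
    { toFun := fun x => mk (f x) (hm x)
      map_add' := fun x y => by
        ext p; simp [mk]; rfl
      map_smul' := fun a x => by
        ext p; simp [mk] }
  have hg : ∀ x, ‖g x‖ ≤ C * ‖x‖ := fun x => by
    refine abs_le_of_sq_le_sq' ?_ (by positivity) |>.2
    rw [mul_pow, ← (norm_sq (g x)).tsum_eq]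
    exact (norm_sq (g x)).summable.tsum_le_of_sum_le (h x)
  exact ⟨g.mkContinuous C hg, g.mkContinuous_norm_le hC hg, fun x p => rfl⟩

lemma ofMat (M : Mat) (K : ℝ) (hK : 0 ≤ K) (h : BoundedWith M K) :
    ∃ T : Op, ‖T‖ ≤ K ∧ (∀ p q, ent T p q = M p q) ∧ ∀ x : H, T x = mulVec M x := by
  have hs : ∀ (x : H) i, Summable fun j => M i j * x j := fun x i =>
    ((h x (mem x)).1 i).of_abs
  let f : H →ₗ[ℝ] (ℕ → ℝ) :=
    { toFun := fun x => mulVec M x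
      map_add' := fun x y => by
        ext p
        simp only [mulVec, lp.coeFn_add, Pi.add_apply, mul_add]
        exact (hs x p).tsum_add (hs y p)
      map_smul' := fun a x => by
        ext p
        simp only [mulVec, lp.coeFn_smul, Pi.smul_apply, smul_eq_mul, RingHom.id_apply]
        rw [← tsum_mul_left]
        congr 1; ext j; ring }
  obtain ⟨T, hT, hTf⟩ := mkop f K hK (fun x F => by
    obtain ⟨_, h2, h3⟩ := h x (mem x)
    rw [l2norm_eq] at h3
    have : l2norm (mulVec M x) ^ 2 = ∑' i, (mulVec M x i) ^ 2 :=
      Real.sq_sqrt (tsum_nonneg fun _ => sq_nonneg _)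
    calc ∑ p ∈ F, (mulVec M x p) ^ 2 ≤ ∑' i, (mulVec M x i) ^ 2 :=
          h2.sum_le_tsum F (fun _ _ => sq_nonneg _)
      _ = l2norm (mulVec M x) ^ 2 := this.symm
      _ ≤ (K * ‖x‖) ^ 2 := by
          have : 0 ≤ l2norm (mulVec M x) := Real.sqrt_nonneg _
          gcongr
      _ = _ := by ring)
  have hc : ∀ x : H, T x = mulVec M x := fun x => by
    ext p; exact hTf x p
  refine ⟨T, hT, fun p q => ?_, hc⟩
  rw [ent, hc, mulVec, tsum_eq_single q]
  · simp [e_apply]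
  · intro j hj; simp [e_apply, hj]

open Classical in
lemma exists_proj (S : ℕ → Prop) : ∃ P : Op, ‖P‖ ≤ 1 ∧ ∀ x p, (P x) p = if S p then x p else 0 := by
  let f : H →ₗ[ℝ] (ℕ → ℝ) :=
    { toFun := fun x p => if S p then x p else 0
      map_add' := fun x y => by
        ext p; by_cases h : S p <;> simp [h]
      map_smul' := fun a x => by
        ext p; by_cases h : S p <;> simp [h] }
  refine mkop f 1 zero_le_one (fun x F => ?_)
  rw [one_pow, one_mul, ← (norm_sq x).tsum_eq]
  refine le_trans (Finset.sum_le_sum fun p _ => ?_)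
    ((norm_sq x).summable.sum_le_tsum F (fun _ _ => sq_nonneg _))
  change (if S p then x p else 0) ^ 2 ≤ _
  split_ifs
  · rfl
  · simpa using sq_nonneg (x p)

open Classical in
noncomputable def P (S : ℕ → Prop) : Op := (exists_proj S).choose

open Classical in
lemma P_norm (S : ℕ → Prop) : ‖P S‖ ≤ 1 := (exists_proj S).choose_spec.1

open Classical in
lemma P_apply (S : ℕ → Prop) (x : H) (p : ℕ) : (P S x) p = if S p then x p else 0 :=
  (exists_proj S).choose_spec.2 x p

lemma diag (c : ℕ → ℤ) (δ : ℤ) (X : ℤ → Op) (η : ℝ) (hη : 0 ≤ η) (hX : ∀ z, ‖X z‖ ≤ η) :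
    ∃ Y : Op, ‖Y‖ ≤ η ∧
      ∀ p q, ent Y p q = if c p - c q = δ then ent (X (c q)) p q else 0 := by
  classical
  let E : ℤ → Op := fun z => P (fun q => c q = z)
  let f : H →ₗ[ℝ] (ℕ → ℝ) :=
    { toFun := fun x p => (X (c p - δ) (E (c p - δ) x)) p
      map_add' := fun x y => by
        ext p; simp
      map_smul' := fun a x => by
        ext p; simp }
  obtain ⟨Y, hY, hYf⟩ := mkop f η hη (fun x F => by
    set G : Finset ℤ := F.image (fun p => c p - δ)
    have h1 : ∀ z, ∑ p ∈ F with c p - δ = z, (f x p) ^ 2 ≤ η ^ 2 * ‖E z x‖ ^ 2 := fun z => by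
      calc ∑ p ∈ F with c p - δ = z, (f x p) ^ 2
          = ∑ p ∈ F with c p - δ = z, ((X z (E z x)) p) ^ 2 := by
            refine Finset.sum_congr rfl fun p hp => ?_
            have := (Finset.mem_filter.1 hp).2
            subst this; rfl
        _ ≤ ‖X z (E z x)‖ ^ 2 := by
            rw [← (norm_sq (X z (E z x))).tsum_eq]
            exact (norm_sq (X z (E z x))).summable.sum_le_tsum _ (fun _ _ => sq_nonneg _)
        _ ≤ (η * ‖E z x‖) ^ 2 := by
            have := ((X z).le_opNorm (E z x)).trans
              (mul_le_mul_of_nonneg_right (hX z) (norm_nonneg _))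
            gcongr
        _ = _ := by ring
    have h2 : ∑ z ∈ G, ‖E z x‖ ^ 2 ≤ ‖x‖ ^ 2 := by
      have hs : HasSum (fun i => ∑ z ∈ G, ((E z x) i) ^ 2) (∑ z ∈ G, ‖E z x‖ ^ 2) :=
        hasSum_sum fun z _ => norm_sq (E z x)
      refine hasSum_le (fun i => ?_) hs (norm_sq x)
      have : ∀ z, ((E z x) i) ^ 2 = if c i = z then (x i) ^ 2 else 0 := fun z => by
        simp only [E, P_apply]; split_ifs <;> simp
      simp only [this, Finset.sum_ite_eq]
      split_ifs
      · rfl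
      · exact sq_nonneg _
    calc ∑ p ∈ F, (f x p) ^ 2 = ∑ z ∈ G, ∑ p ∈ F with c p - δ = z, (f x p) ^ 2 :=
          (Finset.sum_fiberwise_of_maps_to
            (fun p hp => Finset.mem_image_of_mem (fun p => c p - δ) hp) _).symm
      _ ≤ ∑ z ∈ G, η ^ 2 * ‖E z x‖ ^ 2 := Finset.sum_le_sum fun z _ => h1 z
      _ = η ^ 2 * ∑ z ∈ G, ‖E z x‖ ^ 2 := by rw [Finset.mul_sum]
      _ ≤ _ := by gcongr)
  refine ⟨Y, hY, fun p q => ?_⟩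
  rw [ent, hYf]
  change (X (c p - δ) (E (c p - δ) (e q))) p = _
  have hE : E (c p - δ) (e q) = if c p - c q = δ then e q else 0 := by
    ext r
    simp only [E, P_apply]
    by_cases hrq : r = q
    · subst hrq
      by_cases h : c p - c r = δ
      · have : c r = c p - δ := by omega
        simp [h, this]
      · have : ¬ c r = c p - δ := by omega
        simp [h, this]
    · by_cases h : c p - c q = δ <;> simp [h, e_apply, hrq]
  rw [hE]
  split_ifs with h
  · have : c p - δ = c q := by omega
    rw [this]; rfl
  · simp

lemma exists_alpha (T : Op) (c : ℝ) (hc : 0 < c) (h : ∀ x : H, c * ‖x‖ ^ 2 ≤ ⟪T x, x⟫_ℝ) :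
    ∃ α : ℝ, 0 < α ∧ ‖1 - α • T‖ < 1 := by
  set C := max ‖T‖ c with hC
  have hCpos : 0 < C := lt_of_lt_of_le hc (le_max_right _ _)
  set α := c / C ^ 2 with hα
  have hαpos : 0 < α := by positivity
  set q := 1 - c ^ 2 / C ^ 2
  have hq0 : 0 ≤ q := by
    have : c ^ 2 / C ^ 2 ≤ 1 := by
      rw [div_le_one (by positivity)]
      have := le_max_right ‖T‖ c
      gcongr
    simp only [q]; linarith
  have hq1 : q < 1 := by
    have : 0 < c ^ 2 / C ^ 2 := by positivity
    simp only [q]; linarith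
  refine ⟨α, hαpos, lt_of_le_of_lt ?_ (show Real.sqrt q < 1 by
    rw [Real.sqrt_lt' one_pos]; simpa using hq1)⟩
  refine ContinuousLinearMap.opNorm_le_bound _ (Real.sqrt_nonneg _) fun x => ?_
  refine abs_le_of_sq_le_sq' ?_ (by positivity) |>.2
  rw [mul_pow, Real.sq_sqrt hq0]
  have h1 : (1 - α • T) x = x - α • T x := by simp
  rw [h1, norm_sub_sq_real, norm_smul, inner_smul_right, real_inner_comm]
  have h2 : ‖T x‖ ≤ C * ‖x‖ := (T.le_opNorm x).trans (by gcongr; exact le_max_left _ _)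
  have h3 : ‖T x‖ ^ 2 ≤ C ^ 2 * ‖x‖ ^ 2 := by rw [← mul_pow]; gcongr
  have h4 := h x
  have h5 : (‖α‖ * ‖T x‖) ^ 2 ≤ α ^ 2 * (C ^ 2 * ‖x‖ ^ 2) := by
    rw [mul_pow, Real.norm_eq_abs, sq_abs]; gcongr
  have h6 : α * (c * ‖x‖ ^ 2) ≤ α * ⟪T x, x⟫_ℝ := by gcongr
  have h7 : α ^ 2 * (C ^ 2 * ‖x‖ ^ 2) = α * (c * ‖x‖ ^ 2) := by
    simp only [hα]; field_simp
  have h8 : q * ‖x‖ ^ 2 = ‖x‖ ^ 2 - α * (c * ‖x‖ ^ 2) := by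
    simp only [q, hα]; field_simp
  rw [h8]
  linarith

/-- bandedness -/
def Bd (ρ : ℕ → ℕ → ℝ) (b : ℝ) (T : Op) : Prop := ∀ p q, b < ρ p q → ent T p q = 0

lemma ent_add (S T : Op) (p q) : ent (S + T) p q = ent S p q + ent T p q := by simp [ent]
lemma ent_sub (S T : Op) (p q) : ent (S - T) p q = ent S p q - ent T p q := by simp [ent]
lemma ent_smul (a : ℝ) (T : Op) (p q) : ent (a • T) p q = a * ent T p q := by simp [ent]
lemma ent_one (p q) : ent (1 : Op) p q = if p = q then 1 else 0 := by simp [ent, e_apply]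
lemma ent_mul (S T : Op) (p q) : HasSum (fun r => ent S p r * ent T r q) (ent (S * T) p q) :=
  hasSum_apply S (T (e q)) p
lemma ent_sum {ι : Type*} (s : Finset ι) (f : ι → Op) (p q) :
    ent (∑ i ∈ s, f i) p q = ∑ i ∈ s, ent (f i) p q := by
  classical
  induction s using Finset.induction_on with
  | empty => simp [ent]
  | insert a s ha ih => rw [Finset.sum_insert ha, Finset.sum_insert ha, ent_add, ih]

lemma ent_star (T : Op) (p q) : ent (star T) p q = ent T q p := by
  have h : ∀ (x : H) r, x r = ⟪e r, x⟫_ℝ := fun x r => by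
    rw [e, lp.inner_single_left]; simp
  rw [ent, ent, h, h (T _), ContinuousLinearMap.star_eq_adjoint,
    ContinuousLinearMap.adjoint_inner_right, real_inner_comm]

structure PM (ρ : ℕ → ℕ → ℝ) : Prop where
  zero : ∀ p, ρ p p = 0
  symm : ∀ p q, ρ p q = ρ q p
  tri : ∀ p q r, ρ p r ≤ ρ p q + ρ q r

variable {ρ : ℕ → ℕ → ℝ}

lemma Bd.mono {b b' : ℝ} {T : Op} (h : Bd ρ b T) (hb : b ≤ b') : Bd ρ b' T :=
  fun p q hpq => h p q (lt_of_le_of_lt hb hpq)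
lemma Bd.add {b : ℝ} {S T : Op} (hS : Bd ρ b S) (hT : Bd ρ b T) : Bd ρ b (S + T) :=
  fun p q h => by rw [ent_add, hS p q h, hT p q h, add_zero]
lemma Bd.sub {b : ℝ} {S T : Op} (hS : Bd ρ b S) (hT : Bd ρ b T) : Bd ρ b (S - T) :=
  fun p q h => by rw [ent_sub, hS p q h, hT p q h, sub_zero]
lemma Bd.smul {b : ℝ} {T : Op} (a : ℝ) (hT : Bd ρ b T) : Bd ρ b (a • T) :=
  fun p q h => by rw [ent_smul, hT p q h, mul_zero]
lemma Bd.sum {ι : Type*} {b : ℝ} (s : Finset ι) (f : ι → Op) (h : ∀ i ∈ s, Bd ρ b (f i)) :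
    Bd ρ b (∑ i ∈ s, f i) :=
  fun p q hpq => by rw [ent_sum]; exact Finset.sum_eq_zero fun i hi => h i hi p q hpq
lemma Bd.one (hρ : PM ρ) {b : ℝ} (hb : 0 ≤ b) : Bd ρ b 1 := fun p q h => by
  rw [ent_one, if_neg]; rintro rfl; rw [hρ.zero] at h; linarith
lemma Bd.proj (hρ : PM ρ) {b : ℝ} (hb : 0 ≤ b) (S) : Bd ρ b (P S) := fun p q h => by
  have : p ≠ q := by rintro rfl; rw [hρ.zero] at h; linarith
  simp [ent, P_apply, e_apply, this]
lemma Bd.star (hρ : PM ρ) {b : ℝ} {T : Op} (h : Bd ρ b T) : Bd ρ b (star T) := fun p q hpq => by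
  rw [ent_star]; exact h q p (by rwa [hρ.symm])
lemma Bd.mul (hρ : PM ρ) {b b' : ℝ} {S T : Op} (hS : Bd ρ b S) (hT : Bd ρ b' T) :
    Bd ρ (b + b') (S * T) := fun p q hpq => by
  have : (fun r => ent S p r * ent T r q) = fun _ => 0 := by
    ext r
    by_cases h : b < ρ p r
    · rw [hS p r h, zero_mul]
    · rw [hT r q (by have := hρ.tri p r q; linarith), mul_zero]
  have h2 := ent_mul S T p q
  rw [this] at h2
  exact h2.unique hasSum_zero
lemma Bd.pow (hρ : PM ρ) {b : ℝ} {T : Op} (hT : Bd ρ b T) (n : ℕ) :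
    Bd ρ (n * b) (T ^ n) := by
  induction n with
  | zero => simpa using Bd.one hρ le_rfl
  | succ n ih =>
    rw [pow_succ]
    exact (ih.mul hρ hT).mono (by push_cast; linarith)
lemma Bd.geom (hρ : PM ρ) {b : ℝ} (hb : 0 ≤ b) {T : Op} (hT : Bd ρ b T) (n : ℕ) :
    Bd ρ (n * b) (∑ s ∈ Finset.range n, T ^ s) := by
  refine Bd.sum _ _ fun i hi => (hT.pow hρ i).mono ?_
  have : i ≤ n := (Finset.mem_range.1 hi).le
  gcongr


lemma op_pow_le (B : Op) (m : ℕ) : ‖B ^ m‖ ≤ ‖B‖ ^ m := by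
  induction m with
  | zero => rw [pow_zero, pow_zero]; exact ContinuousLinearMap.norm_id_le
  | succ n ih =>
    rw [pow_succ, pow_succ]
    exact (norm_mul_le _ _).trans (by gcongr)

lemma geomTail (B : Op) (q : ℝ) (hq : q < 1) (hB : ‖B‖ ≤ q) :
    ∃ G : Op, G = 1 + B * G ∧
      ∀ m : ℕ, ‖G - ∑ s ∈ Finset.range m, B ^ s‖ ≤ q ^ m * (1 - q)⁻¹ := by
  have hB1 : ‖B‖ < 1 := lt_of_le_of_lt hB hq
  have hq0 : 0 ≤ q := (norm_nonneg _).trans hB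
  have h1 := mul_neg_geom_series B hB1
  set G := ∑' i : ℕ, B ^ i with hG
  have h2 : G = 1 + B * G := by
    rw [sub_mul, one_mul] at h1
    rw [← h1]; abel
  have hGn : ‖G‖ ≤ (1 - q)⁻¹ := by
    have h3 : ‖G‖ ≤ 1 + q * ‖G‖ := by
      calc ‖G‖ = ‖1 + B * G‖ := by rw [← h2]
        _ ≤ ‖(1 : Op)‖ + ‖B * G‖ := norm_add_le _ _
        _ ≤ 1 + ‖B‖ * ‖G‖ := add_le_add ContinuousLinearMap.norm_id_le (norm_mul_le _ _)
        _ ≤ _ := by gcongr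
    rw [← one_div, le_div_iff₀ (by linarith)]
    linarith
  refine ⟨G, h2, fun m => ?_⟩
  have h4 : G - ∑ s ∈ Finset.range m, B ^ s = B ^ m * G := by
    have : ∑ s ∈ Finset.range m, B ^ s = (1 - B ^ m) * G := by
      rw [← geom_sum_mul_neg, mul_assoc, h1, mul_one]
    rw [this, sub_mul, one_mul]; abel
  rw [h4]
  have hpow : ‖B ^ m‖ ≤ q ^ m := by
    calc ‖B ^ m‖ ≤ ‖B‖ ^ m := op_pow_le B m
      _ ≤ q ^ m := by gcongr
  calc ‖B ^ m * G‖ ≤ ‖B ^ m‖ * ‖G‖ := norm_mul_le _ _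
    _ ≤ _ := by gcongr

variable {blk : ℕ → ℕ}

def Low (blk : ℕ → ℕ) (L : Op) : Prop := ∀ p q, blk p < blk q → ent L p q = 0
def Upp (blk : ℕ → ℕ) (L : Op) : Prop := ∀ p q, blk q < blk p → ent L p q = 0
def Unt (blk : ℕ → ℕ) (L : Op) : Prop :=
  ∀ p q, blk p = blk q → ent L p q = if p = q then 1 else 0

lemma low_step {L : Op} (hL : Low blk L) (hLu : Unt blk L) (w : H) (p : ℕ)
    (h : ∀ r, blk r < blk p → w r = 0) : (L w) p = w p := by
  have h1 := hasSum_apply L w p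
  have h2 : (fun q => ent L p q * w q) = fun q => if q = p then w p else 0 := by
    ext r
    rcases lt_trichotomy (blk r) (blk p) with hr | hr | hr
    · rw [h r hr, mul_zero, if_neg]; rintro rfl; omega
    · rw [hLu p r hr.symm]
      by_cases hrp : r = p
      · subst hrp; simp
      · simp [hrp, Ne.symm hrp]
    · rw [hL p r hr, zero_mul, if_neg]; rintro rfl; omega
  rw [h2] at h1
  exact h1.unique (hasSum_ite_eq p (w p))

lemma low_vanish {L : Op} (hL : Low blk L) (hLu : Unt blk L) (w : H) (z : ℕ)
    (h : ∀ p, blk p < z → (L w) p = 0) : ∀ p, blk p < z → w p = 0 := by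
  have : ∀ k p, blk p = k → blk p < z → w p = 0 := by
    intro k
    induction k using Nat.strong_induction_on with
    | _ k ih =>
      intro p hp hz
      rw [← low_step hL hLu w p (fun r hr => ih (blk r) (hp ▸ hr) r rfl (hr.trans hz))]
      exact h p hz
  exact fun p => this _ p rfl

lemma inv_low {L N : Op} (hL : Low blk L) (hLu : Unt blk L) (hLN : L * N = 1) :
    Low blk N ∧ Unt blk N := by
  have h1 : ∀ q, L (N (e q)) = e q := fun q => by
    change (L * N) (e q) = e q
    rw [hLN]; rfl
  have hlow : Low blk N := fun p q hpq =>
    low_vanish hL hLu (N (e q)) (blk q) (fun r hr => by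
      rw [h1, e_apply, if_neg]; rintro rfl; omega) p hpq
  refine ⟨hlow, fun p q hpq => ?_⟩
  have := low_step hL hLu (N (e q)) p (fun r hr => hlow r q (hpq ▸ hr))
  rw [h1, e_apply] at this
  exact this.symm

noncomputable def ρb (blk : ℕ → ℕ) (p q : ℕ) : ℝ := |(blk p : ℝ) - blk q|

lemma pm_ρb : PM (ρb blk) where
  zero p := by simp [ρb]
  symm p q := abs_sub_comm _ _
  tri p q r := abs_sub_le _ _ _

lemma P_of {S : ℕ → Prop} {x : H} (h : ∀ p, ¬ S p → x p = 0) : P S x = x := by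
  classical
  ext p; rw [P_apply]; split_ifs with hp
  · rfl
  · exact (h p hp).symm

/-- the key column identity -/
lemma column {M L U : Op} (hM : M = L * U) (hL : Low blk L) (hLu : Unt blk L) (hU : Upp blk U)
    (α : ℝ) (q : ℕ) (G : Op)
    (hG : G = 1 + (P (fun r => blk r ≤ blk q) * (1 - α • M) * P (fun r => blk r ≤ blk q)) * G) :
    L (e q) = (α • (M * G)) (e q) ∧ ∀ p, blk q < blk p → (G (e q)) p = 0 := by
  classical
  set S : ℕ → Prop := fun r => blk r ≤ blk q with hS
  have hPe : P S (e q) = e q := P_of fun p hp => by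
    rw [e_apply, if_neg]; rintro rfl; exact hp le_rfl
  set g := G (e q) with hg
  have hgeq : g = e q + P S ((1 - α • M) (P S g)) := by
    have := congrArg (fun T : Op => T (e q)) hG
    simpa using this
  have hgs : ∀ p, ¬ S p → g p = 0 := fun p hp => by
    have h1 : p ≠ q := by rintro rfl; exact hp le_rfl
    rw [hgeq, lp.coeFn_add, Pi.add_apply, P_apply, if_neg hp, e_apply, if_neg h1, add_zero]
  have hPg : P S g = g := P_of hgs
  refine ⟨?_, fun p hp => hgs p (by simp only [hS]; omega)⟩
  have hPM : P S (α • M g) = e q := by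
    have h1 : g = e q + (P S g - P S (α • M g)) := by
      conv_lhs => rw [hgeq]
      rw [hPg]; simp [hPg]
    rw [hPg] at h1
    have h2 : (0 : H) = e q - P S (α • M g) := by
      have h3 : g = g + (e q - P S (α • M g)) := by
        conv_lhs => rw [h1]
        abel
      exact (left_eq_add.1 h3).symm
    exact (sub_eq_zero.1 h2.symm).symm
  set u := α • U g with hu
  have hLuM : L u = α • M g := by rw [hu, map_smul, hM]; rfl
  have hus : ∀ p, ¬ S p → u p = 0 := fun p hp => by
    have h1 := hasSum_apply U g p
    have h2 : (fun r => ent U p r * g r) = fun _ => 0 := by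
      ext r
      by_cases hr : S r
      · rw [hU p r (by simp only [hS] at hr hp; omega), zero_mul]
      · rw [hgs r hr, mul_zero]
    rw [h2] at h1
    have := h1.unique hasSum_zero
    rw [hu]; simp [this]
  have hw : u = e q := by
    have hv := low_vanish hL hLu (u - e q) (blk q + 1) (fun p hp => by
      have hSp : S p := by simp only [hS]; omega
      have h1 : (L u) p = e q p := by
        rw [hLuM, ← hPM, P_apply, if_pos hSp]
      have h2 : (L (e q)) p = e q p := by
        change ent L p q = _
        rw [e_apply]
        rcases Nat.lt_or_ge (blk p) (blk q) with h | h
        · rw [hL p q h, if_neg]; rintro rfl; omega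
        · exact hLu p q (le_antisymm hSp h)
      rw [map_sub, lp.coeFn_sub, Pi.sub_apply, h1, h2, sub_self])
    ext p
    by_cases hp : S p
    · have := hv p (by simp only [hS] at hp; omega)
      rw [lp.coeFn_sub, Pi.sub_apply] at this
      linarith
    · rw [hus p hp, e_apply, if_neg]; rintro rfl; exact hp le_rfl
  rw [show L (e q) = L u by rw [hw], hLuM]; rfl

lemma tendsto_small (q A B : ℝ) (hq0 : 0 ≤ q) (hq : q < 1) (ε : ℝ) (hε : 0 < ε) :
    ∃ m : ℕ, (A * m + B) * q ^ m < ε := by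
  have h1 := tendsto_self_mul_const_pow_of_lt_one hq0 hq
  have h2 := tendsto_pow_atTop_nhds_zero_of_lt_one hq0 hq
  have h3 := (h1.const_mul A).add (h2.const_mul B)
  simp only [mul_zero, add_zero] at h3
  obtain ⟨m, hm⟩ := (h3.eventually (gt_mem_nhds hε)).exists
  exact ⟨m, by linarith⟩

lemma approx_L {M L U : Op} (hM : M = L * U) (hL : Low blk L) (hLu : Unt blk L) (hU : Upp blk U)
    (α : ℝ) (hα : ‖1 - α • M‖ < 1) (d : ℕ → ℕ → ℝ) (hd : PM d) (b₀ : ℕ)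
    (hMd : Bd d b₀ M) (hMb : Bd (ρb blk) b₀ M) (η : ℝ) (hη : 0 < η) :
    ∃ L' : Op, ‖L' - L‖ < η ∧ Bd (ρb blk) b₀ L' ∧ ∃ b : ℝ, Bd d b L' := by
  set q := ‖1 - α • M‖ with hq
  have hq0 : 0 ≤ q := norm_nonneg _
  let S : ℤ → ℕ → Prop := fun z r => (blk r : ℤ) ≤ z
  let B : ℤ → Op := fun z => P (S z) * (1 - α • M) * P (S z)
  have hB : ∀ z, ‖B z‖ ≤ q := fun z => by
    calc ‖B z‖ ≤ ‖P (S z)‖ * ‖1 - α • M‖ * ‖P (S z)‖ := by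
          refine (norm_mul_le _ _).trans ?_
          gcongr
          exact norm_mul_le _ _
      _ ≤ 1 * q * 1 := by
          gcongr
          · exact P_norm _
          · exact P_norm _
      _ = q := by ring
  choose G hG hGm using fun z => geomTail (B z) q hα (hB z)
  set D := (b₀ + 1 : ℝ) * (‖α • M‖ * (1 - q)⁻¹) with hD
  obtain ⟨m, hm⟩ := tendsto_small q 0 D hq0 hα η hη
  let X : ℤ → Op := fun z => α • (M * ∑ s ∈ Finset.range m, B z ^ s)
  let Y : ℤ → Op := fun z => α • (M * G z)
  have h1q : 0 ≤ (1 - q)⁻¹ := inv_nonneg.2 (by linarith)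
  have hXY : ∀ z, ‖Y z - X z‖ ≤ ‖α • M‖ * (q ^ m * (1 - q)⁻¹) := fun z => by
    have : Y z - X z = (α • M) * (G z - ∑ s ∈ Finset.range m, B z ^ s) := by
      simp only [X, Y]; rw [mul_sub, smul_mul_assoc, smul_mul_assoc]
    rw [this]
    refine (norm_mul_le _ _).trans ?_
    gcongr
    exact hGm z m
  choose T hTn hT using fun δ : ℕ => diag (fun p => (blk p : ℤ)) (δ : ℤ) (fun z => Y z - X z) _
    (by positivity) hXY
  have hcol : ∀ p r, ent L p r = ent (Y (blk r)) p r := fun p r => by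
    have := (column hM hL hLu hU α r (G (blk r)) (by
      have := hG (blk r)
      simpa [B, S] using this)).1
    simp only [ent, Y]; rw [this]
  have hLb : ∀ p r, blk r + b₀ < blk p → ent L p r = 0 := fun p r hpr => by
    have h0 := (column hM hL hLu hU α r (G (blk r)) (by
      have := hG (blk r)
      simpa [B, S] using this))
    have : ent L p r = α * (M (G (blk r) (e r))) p := by
      simp only [ent]; rw [h0.1]; simp
    rw [this]
    have h1 := hasSum_apply M (G (blk r) (e r)) p
    have h2 : (fun s => ent M p s * (G (blk r) (e r)) s) = fun _ => 0 := by
      ext s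
      rcases Nat.lt_or_ge (blk r) (blk s) with h | h
      · rw [h0.2 s h, mul_zero]
      · rw [hMb p s, zero_mul]
        have : (blk s : ℝ) + b₀ < blk p := by exact_mod_cast (by omega : blk s + b₀ < blk p)
        rw [ρb]
        exact lt_of_lt_of_le (by linarith) (le_abs_self _)
    rw [h2] at h1
    rw [h1.unique hasSum_zero, mul_zero]
  let L' : Op := L - ∑ δ ∈ Finset.range (b₀ + 1), T δ
  have hent : ∀ p r, ent L' p r =
      if blk r ≤ blk p ∧ blk p ≤ blk r + b₀ then ent (X (blk r)) p r else 0 := fun p r => by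
    simp only [L', ent_sub, ent_sum, hT]
    split_ifs with h
    · rw [Finset.sum_eq_single (blk p - blk r)]
      · rw [if_pos (by omega), hcol]; ring
      · intro δ _ hδ; rw [if_neg (by omega)]
      · intro hn; exact absurd (Finset.mem_range.2 (by omega)) hn
    · rw [Finset.sum_eq_zero, sub_zero]
      · rcases Nat.lt_or_ge (blk p) (blk r) with h' | h'
        · exact hL p r h'
        · exact hLb p r (by omega)
      · intro δ hδ
        have := Finset.mem_range.1 hδ
        rw [if_neg (by omega)]
  refine ⟨L', ?_, ?_, b₀ + m * b₀, ?_⟩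
  · have : L' - L = - ∑ δ ∈ Finset.range (b₀ + 1), T δ := by simp [L']
    rw [this, norm_neg]
    calc _ ≤ ∑ δ ∈ Finset.range (b₀ + 1), ‖T δ‖ := norm_sum_le _ _
      _ ≤ ∑ δ ∈ Finset.range (b₀ + 1), ‖α • M‖ * (q ^ m * (1 - q)⁻¹) :=
          Finset.sum_le_sum fun δ _ => hTn δ
      _ = (0 * m + D) * q ^ m := by simp [hD]; ring
      _ < η := hm
  · intro p r h
    rw [hent, if_neg]
    rintro ⟨h1, h2⟩
    have h1' : (blk r : ℝ) ≤ blk p := by exact_mod_cast h1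
    have h2' : (blk p : ℝ) ≤ blk r + b₀ := by exact_mod_cast h2
    rw [ρb, abs_of_nonneg (by linarith)] at h
    linarith
  · intro p r h
    rw [hent]
    split_ifs
    · have hb0 : (0 : ℝ) ≤ b₀ := by positivity
      have hBz : Bd d b₀ (B (blk r)) := by
        have h1 : Bd d b₀ (1 - α • M) := (Bd.one hd hb0).sub (hMd.smul α)
        have h2 := ((Bd.proj hd le_rfl (S (blk r))).mul hd h1).mul hd
          (Bd.proj hd le_rfl (S (blk r)))
        exact h2.mono (by linarith)
      exact ((hMd.mul hd (hBz.geom hd hb0 m)).smul α) p r h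
    · rfl

lemma approx_inv {M L U N : Op} (hM : M = L * U) (hL : Low blk L) (hLu : Unt blk L)
    (hU : Upp blk U) (hLN : L * N = 1) (hNL : N * L = 1)
    (α : ℝ) (hα : ‖1 - α • M‖ < 1) (d : ℕ → ℕ → ℝ) (hd : PM d) (b₀ : ℕ)
    (hMd : Bd d b₀ M) (hMb : Bd (ρb blk) b₀ M) (ε : ℝ) (hε : 0 < ε) :
    ∃ W : Op, Low blk W ∧ Unt blk W ∧ (∃ b : ℝ, Bd d b W ∧ Bd (ρb blk) b W) ∧ ‖N - W‖ ≤ ε := by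
  obtain ⟨hN, hNu⟩ := inv_low hL hLu hLN
  -- ellipticity of `L* L`
  have hell : ∀ x : H, (1 / (‖N‖ + 1) ^ 2) * ‖x‖ ^ 2 ≤ ⟪(star L * L) x, x⟫_ℝ := fun x => by
    have h1 : ⟪(star L * L) x, x⟫_ℝ = ‖L x‖ ^ 2 := by
      rw [ContinuousLinearMap.star_eq_adjoint, mul_apply_eq_comp,
        ContinuousLinearMap.adjoint_inner_left, real_inner_self_eq_norm_sq]
    have h2 : ‖x‖ ≤ (‖N‖ + 1) * ‖L x‖ := by
      calc ‖x‖ = ‖N (L x)‖ := by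
            rw [← mul_apply_eq_comp, hNL]; rfl
        _ ≤ ‖N‖ * ‖L x‖ := N.le_opNorm _
        _ ≤ _ := by gcongr; linarith
    rw [h1, one_div, inv_mul_le_iff₀ (by positivity), ← mul_pow]
    gcongr
  obtain ⟨γ, hγ, hγ1⟩ := exists_alpha (star L * L) _ (by positivity) hell
  set q := ‖1 - γ • (star L * L)‖ with hq
  have hq0 : 0 ≤ q := norm_nonneg _
  let F : ℕ → Op → Op := fun m X =>
    γ • ((∑ s ∈ Finset.range m, (1 - γ • (star X * X)) ^ s) * star X)
  have hFL : ∀ m, ‖F m L - N‖ ≤ q ^ m * ‖N‖ := fun m => by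
    have h1 : F m L = (1 - (1 - γ • (star L * L)) ^ m) * N := by
      rw [← geom_sum_mul_neg]
      simp only [F, sub_sub_cancel]
      rw [mul_smul_comm, smul_mul_assoc, mul_assoc, mul_assoc, hLN, mul_one]
    have h2 : F m L - N = - ((1 - γ • (star L * L)) ^ m * N) := by
      rw [h1, sub_mul, one_mul]; abel
    rw [h2, norm_neg]
    refine (norm_mul_le _ _).trans ?_
    gcongr
    exact op_pow_le _ _
  have hFc : ∀ m, Continuous (F m) := fun m => by
    simp only [F]; fun_prop
  -- choice of `m`
  obtain ⟨m, hm⟩ := tendsto_small q (2 * b₀ * (‖N‖ + 1)) ((b₀ + 2) * (‖N‖ + 1) ) hq0 hγ1 ε hε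
  set β : ℕ := (2 * m + 1) * b₀ with hβ
  -- choice of `η`
  obtain ⟨κ, hκ, hκm⟩ : ∃ κ : ℝ, 0 < κ ∧ (β + 2) * (q ^ m * ‖N‖ + κ) ≤ ε := by
    have h1 : (β + 2 : ℝ) * (q ^ m * ‖N‖) < ε := by
      refine lt_of_le_of_lt ?_ hm
      have h2 : (β : ℝ) = (2 * m + 1) * b₀ := by simp [hβ]
      have : (2 * ↑b₀ * (‖N‖ + 1) * ↑m + (↑b₀ + 2) * (‖N‖ + 1)) * q ^ m
        = (β + 2) * (q ^ m * (‖N‖ + 1)) := by rw [h2]; ring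
      rw [this]
      gcongr
      linarith
    refine ⟨(ε - (β + 2) * (q ^ m * ‖N‖)) / (β + 2), div_pos (by linarith) (by positivity), ?_⟩
    rw [mul_add, mul_div_cancel₀ _ (by positivity)]
    linarith
  obtain ⟨η, hη, hηF⟩ := Metric.continuous_iff.1 (hFc m) L κ hκ
  obtain ⟨L', hL'1, hL'b, b, hL'd⟩ := approx_L hM hL hLu hU α hα d hd b₀ hMd hMb η hη
  set W0 := F m L' with hW0
  have hW0N : ‖W0 - N‖ ≤ q ^ m * ‖N‖ + κ := by
    have h1 := hηF L' (by rwa [dist_eq_norm])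
    rw [dist_eq_norm] at h1
    calc ‖W0 - N‖ = ‖(F m L - N) + (F m L' - F m L)‖ := by rw [hW0]; congr 1; abel
      _ ≤ _ := (norm_add_le _ _).trans (add_le_add (hFL m) h1.le)
  have hFband : ∀ (ρ : ℕ → ℕ → ℝ) (hρ : PM ρ) (t : ℝ) (ht : 0 ≤ t), Bd ρ t L' →
      Bd ρ ((2 * m + 1) * t) W0 := fun ρ hρ t ht hB => by
    have h1 : Bd ρ (t + t) (1 - γ • (star L' * L')) :=
      (Bd.one hρ (by linarith)).sub (((hB.star hρ).mul hρ hB).smul γ)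
    have h2 := ((h1.geom hρ (by linarith) m).mul hρ (hB.star hρ)).smul γ
    exact h2.mono (by linarith)
  have hW0b : Bd (ρb blk) β W0 := by
    have := hFband _ pm_ρb b₀ (by positivity) hL'b
    refine this.mono (by simp [hβ])
  have hW0d := hFband d hd (max b 0) (le_max_right _ _) (hL'd.mono (le_max_left _ _))
  have hnn : 0 ≤ q ^ m * ‖N‖ + κ := (norm_nonneg _).trans hW0N
  choose T hTn hT using fun δ : ℕ => diag (fun p => (blk p : ℤ)) (-(δ : ℤ)) (fun _ => W0 - N) _
    hnn (fun _ => hW0N)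
  let W : Op := W0 - ∑ δ ∈ Finset.range (β + 1), T δ
  have hup : ∀ p r, blk p ≤ blk r → ent W p r = ent N p r := fun p r hpr => by
    simp only [W, ent_sub, ent_sum, hT]
    by_cases h : blk r ≤ blk p + β
    · rw [Finset.sum_eq_single (blk r - blk p)]
      · rw [if_pos (by omega)]; ring
      · intro δ _ hδ; rw [if_neg (by omega)]
      · intro hn; exact absurd (Finset.mem_range.2 (by omega)) hn
    · rw [Finset.sum_eq_zero, sub_zero, hN p r (by omega)]
      · apply hW0b
        have : (blk p : ℝ) + β < blk r := by exact_mod_cast (by omega : blk p + β < blk r)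
        rw [pm_ρb.symm, ρb]
        exact lt_of_lt_of_le (by linarith) (le_abs_self _)
      · intro δ hδ
        have := Finset.mem_range.1 hδ
        rw [if_neg (by omega)]
  have hlo : ∀ p r, blk r < blk p → ent W p r = ent W0 p r := fun p r hpr => by
    simp only [W, ent_sub, ent_sum, hT]
    rw [Finset.sum_eq_zero, sub_zero]
    intro δ hδ
    rw [if_neg (by omega)]
  have hWl : Low blk W := fun p r h => by rw [hup p r h.le, hN p r h]
  have hWu : Unt blk W := fun p r h => by rw [hup p r h.le, hNu p r h]
  have hband : ∀ (ρ : ℕ → ℕ → ℝ) (hρ : PM ρ) (t : ℝ), 0 ≤ t → Bd ρ t W0 → Bd ρ t W := by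
    intro ρ hρ t ht hB p r h
    rcases lt_trichotomy (blk p) (blk r) with h' | h' | h'
    · exact hWl p r h'
    · rw [hWu p r h', if_neg]; rintro rfl; rw [hρ.zero] at h; linarith
    · rw [hlo p r h']; exact hB p r h
  have hd0 : (0 : ℝ) ≤ (2 * m + 1) * max b 0 := by positivity
  refine ⟨W, hWl, hWu, ⟨max ((2 * m + 1) * max b 0) β,
    (hband d hd _ hd0 hW0d).mono (le_max_left _ _),
    (hband _ pm_ρb _ (by positivity) hW0b).mono (le_max_right _ _)⟩, ?_⟩
  have : N - W = -(W0 - N) + ∑ δ ∈ Finset.range (β + 1), T δ := by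
    simp only [W]; abel
  rw [this]
  calc _ ≤ ‖-(W0 - N)‖ + ‖∑ δ ∈ Finset.range (β + 1), T δ‖ := norm_add_le _ _
    _ ≤ (q ^ m * ‖N‖ + κ) + ∑ δ ∈ Finset.range (β + 1), (q ^ m * ‖N‖ + κ) := by
        rw [norm_neg]
        exact add_le_add hW0N ((norm_sum_le _ _).trans (Finset.sum_le_sum fun δ _ => hTn δ))
    _ = (β + 2) * (q ^ m * ‖N‖ + κ) := by simp; ring
    _ ≤ ε := hκm

lemma exists_blk (n : ℕ → ℕ) (hn : IsBlockStructure n) :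
    ∃ blk : ℕ → ℕ, ∀ i p, InBlock n i p ↔ blk p = i := by
  have h1 : ∀ p, ∃ i, InBlock n i p := fun p => by
    have hex : ∃ k, p < n (k + 1) := ⟨p, lt_of_lt_of_le (Nat.lt_succ_self p) (hn.1.id_le _)⟩
    classical
    refine ⟨Nat.find hex, ?_, Nat.find_spec hex⟩
    rcases Nat.eq_zero_or_pos (Nat.find hex) with h | h
    · rw [h, hn.2]; exact Nat.zero_le _
    · have := Nat.find_min hex (m := Nat.find hex - 1) (by omega)
      rw [Nat.sub_add_cancel h] at this
      omega
  choose blk hblk using h1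
  refine ⟨blk, fun i p => ⟨fun h => ?_, fun h => h ▸ hblk p⟩⟩
  obtain ⟨h2, h3⟩ := hblk p
  obtain ⟨h4, h5⟩ := h
  have h6 : blk p < i + 1 := hn.1.lt_iff_lt.1 (lt_of_le_of_lt h2 h5)
  have h7 : i < blk p + 1 := hn.1.lt_iff_lt.1 (lt_of_le_of_lt h4 h3)
  omega

lemma inverse_ops {A B : Mat} {S T : Op} (hS : ∀ x : H, S x = mulVec A x)
    (hT : ∀ x : H, T x = mulVec B x) (h : IsInverseOn A B) : S * T = 1 ∧ T * S = 1 := by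
  constructor
  · ext x p
    have := (h x (mem x)).2.2.2
    rw [← hT, ← hS] at this
    exact congrFun this p
  · ext x p
    have := (h x (mem x)).2.2.1
    rw [← hS, ← hT] at this
    exact congrFun this p

lemma inverse_of_ops {S T : Op} (h1 : S * T = 1) (h2 : T * S = 1) :
    IsInverseOn (ent S) (ent T) := by
  intro x hx
  have hS := (bounded_ent S _ le_rfl).2
  have hT := (bounded_ent T _ le_rfl).2
  have hx' : x = (mk x hx : H) := rfl
  rw [hx', hS, hT, hS, hT]
  refine ⟨mem _, mem _, ?_, ?_⟩
  · rw [← mul_apply_eq_comp, h2]; rfl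
  · rw [← mul_apply_eq_comp, h1]; rfl

end BA

/-- banded approximation `W` of `L⁻¹` (block-lower triangular with unit
diagonal blocks, banded and block-banded), with `‖L⁻¹ − W‖₂ ≤ ε` and `W` invertible
with `‖W‖₂ + ‖W⁻¹‖₂ ≤ K` uniformly in `ε`. -/
theorem banded_approximation_of_L_inverse
    (M : Mat) (hbdd : IsBoundedOp M)
    (Cell : ℝ) (hCell : 0 < Cell) (hell : Elliptic M Cell)
    (nseq : ℕ → ℕ) (hn : IsBlockStructure nseq)
    (b₀ : ℕ) (hbb : BlockBanded nseq b₀ M)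
    (d : ℕ → ℕ → ℝ) (hd : IsMetric d) (hband : Banded d (b₀ : ℝ) M)
    (L U : Mat)
    (hL : BlockLower nseq L) (hLd : UnitDiagBlocks nseq L) (hU : BlockUpper nseq U)
    (hLU : ∀ p q, M p q = ∑' r, L p r * U r q)
    (hLb : IsBoundedOp L) (hUb : IsBoundedOp U)
    (Linv Uinv : Mat)
    (hLinv : IsInverseOn L Linv) (hLinvb : IsBoundedOp Linv)
    (hUinv : IsInverseOn U Uinv) (hUinvb : IsBoundedOp Uinv) :
    ∃ ε₀ K : ℝ, 0 < ε₀ ∧ 0 < K ∧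
      ∀ ε : ℝ, 0 < ε → ε ≤ ε₀ →
        ∃ b : ℕ, ∃ W : Mat,
          BlockLower nseq W ∧ UnitDiagBlocks nseq W ∧
          Banded d (b : ℝ) W ∧ BlockBanded nseq b W ∧
          BoundedWith (matSub Linv W) ε ∧
          ∃ Winv : Mat, IsInverseOn W Winv ∧
            ∃ s t : ℝ, 0 ≤ s ∧ 0 ≤ t ∧ s + t ≤ K ∧
              BoundedWith W s ∧ BoundedWith Winv t := by

  obtain ⟨KM, hKM, hM'⟩ := hbdd
  obtain ⟨KL, hKL, hL'⟩ := hLb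
  obtain ⟨KU, hKU, hU'⟩ := hUb
  obtain ⟨KN, hKN, hN'⟩ := hLinvb
  obtain ⟨Mo, -, hMe, hMv⟩ := BA.ofMat M KM hKM hM'
  obtain ⟨Lo, hLn, hLe, hLv⟩ := BA.ofMat L KL hKL hL'
  obtain ⟨Uo, -, hUe, hUv⟩ := BA.ofMat U KU hKU hU'
  obtain ⟨No, hNn, hNe, hNv⟩ := BA.ofMat Linv KN hKN hN'
  obtain ⟨blk, hblk⟩ := BA.exists_blk nseq hn
  have hib : ∀ p, InBlock nseq (blk p) p := fun p => (hblk _ _).2 rfl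
  obtain ⟨hLN, hNL⟩ := BA.inverse_ops hLv hNv hLinv
  have hMLU : Mo = Lo * Uo := BA.ext_ent fun p q => by
    rw [hMe, hLU, ← (BA.ent_mul Lo Uo p q).tsum_eq]
    simp only [hLe, hUe]
  have hLow : BA.Low blk Lo := fun p q h => by
    rw [hLe]; exact hL _ _ p q (hib p) (hib q) h
  have hUpp : BA.Upp blk Uo := fun p q h => by
    rw [hUe]; exact hU _ _ p q (hib p) (hib q) h
  have hUnt : BA.Unt blk Lo := fun p q h => by
    rw [hLe]; exact hLd _ p q (hib p) (h ▸ hib q)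
  have hdPM : BA.PM d := ⟨fun p => (hd.2.1 p p).2 rfl, hd.2.2.1, hd.2.2.2⟩
  have hMd : BA.Bd d b₀ Mo := fun p q h => by rw [hMe]; exact hband p q h
  have hMb : BA.Bd (BA.ρb blk) b₀ Mo := fun p q h => by
    rw [hMe]
    refine hbb _ _ p q (hib p) (hib q) ?_
    rw [BA.ρb] at h
    exact_mod_cast h
  obtain ⟨α, -, hα⟩ := BA.exists_alpha Mo Cell hCell (fun x => by
    have h1 := hell x (BA.mem x)
    rw [(BA.norm_sq x).tsum_eq, ← hMv] at h1
    rw [lp.inner_eq_tsum]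
    refine h1.trans (le_of_eq ?_)
    congr 1; ext i
    simp [mul_comm])
  refine ⟨1 / (2 * (KL + 1)), KN + 1 / (2 * (KL + 1)) + 2 * (KL + 1), by positivity, by positivity,
    fun ε hε hε0 => ?_⟩
  obtain ⟨W, hWl, hWu, ⟨b, hWd, hWb⟩, hWN⟩ := BA.approx_inv hMLU hLow hUnt hUpp hLN hNL α hα d hdPM
    b₀ hMd hMb ε hε
  obtain ⟨k, hk⟩ := exists_nat_ge b
  -- inverse of `W`
  have hsmall : ‖(No - W) * Lo‖ ≤ 1 / 2 := by
    calc ‖(No - W) * Lo‖ ≤ ‖No - W‖ * ‖Lo‖ := norm_mul_le _ _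
      _ ≤ 1 / (2 * (KL + 1)) * (KL + 1) := by
          gcongr
          · exact hWN.trans hε0
          · linarith
      _ = 1 / 2 := by field_simp
  set B := (No - W) * Lo with hB
  have hWB : W = (1 - B) * No := by
    rw [hB, sub_mul, one_mul, mul_assoc, hLN, mul_one]; abel
  have hB1 : ‖B‖ < 1 := by linarith
  have hg1 := geom_series_mul_neg B hB1
  have hg2 := mul_neg_geom_series B hB1
  set G := ∑' i : ℕ, B ^ i with hG
  have hGn : ‖G‖ ≤ 2 := by
    have h2 : G = 1 + B * G := by
      rw [sub_mul, one_mul] at hg2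
      rw [← hg2]; abel
    have h3 : ‖G‖ ≤ 1 + 1 / 2 * ‖G‖ := by
      calc ‖G‖ = ‖1 + B * G‖ := by rw [← h2]
        _ ≤ ‖(1 : BA.Op)‖ + ‖B * G‖ := norm_add_le _ _
        _ ≤ 1 + ‖B‖ * ‖G‖ := add_le_add ContinuousLinearMap.norm_id_le (norm_mul_le _ _)
        _ ≤ _ := by gcongr
    linarith
  have hinv1 : W * (Lo * G) = 1 := by
    rw [hWB, mul_assoc, ← mul_assoc No, hNL, one_mul, hg2]
  have hinv2 : (Lo * G) * W = 1 := by
    rw [hWB, mul_assoc, ← mul_assoc G, hg1, one_mul, hLN]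
  refine ⟨k, BA.ent W, ?_, ?_, ?_, ?_, ?_, BA.ent (Lo * G), BA.inverse_of_ops hinv1 hinv2,
    KN + 1 / (2 * (KL + 1)), 2 * (KL + 1), by positivity, by positivity, le_rfl, ?_, ?_⟩
  · intro i j p q hp hq hij
    rw [hblk] at hp hq
    exact hWl p q (by omega)
  · intro i p q hp hq
    rw [hblk] at hp hq
    exact hWu p q (by omega)
  · exact hWd.mono hk
  · intro i j p q hp hq hij
    rw [hblk] at hp hq
    refine (hWb.mono hk) p q ?_
    rw [BA.ρb, hp, hq]
    exact_mod_cast hij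
  · have : matSub Linv (BA.ent W) = BA.ent (No - W) := by
      ext p q; rw [BA.ent_sub, hNe]; rfl
    rw [this]
    exact (BA.bounded_ent _ _ hWN).1
  · refine (BA.bounded_ent _ _ ?_).1
    calc ‖W‖ = ‖No - (No - W)‖ := by congr 1; abel
      _ ≤ ‖No‖ + ‖No - W‖ := norm_sub_le _ _
      _ ≤ _ := add_le_add hNn (hWN.trans hε0)
  · refine (BA.bounded_ent _ _ ?_).1
    calc ‖Lo * G‖ ≤ ‖Lo‖ * ‖G‖ := norm_mul_le _ _
      _ ≤ (KL + 1) * 2 := by gcongr; linarith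
      _ = _ := by ring
end
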